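/- arXiv:2505.00960 — 3 statements merged into one kernel-verified Lean document; each statement's English description precedes it below -/
import Mathlib

section
/- Let $f \in \mathbb{C}[X_1,\dots,X_n]$ be an irreducible square-free polynomial, i.e. $f = \sum_{I \subseteq [n]} c_I \prod_{i \in I} X_i$ for some $c_I \in \mathbb{C}$. Then the hypersurface $Z = V(f) \subseteq \mathbb{A}^n$ is normal. -/
open MvPolynomial MeasureTheory Metric

namespace AffineHyp

/-- `f` is square-free: every variable occurs with degree at most `1` in each monomial. -/
def IsSquarefreePoly {σ : Type} (f : MvPolynomial σ ℂ) : Prop :=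
  ∀ p ∈ f.support, ∀ i, p i ≤ 1

/-- The affine hypersurface `V(f) ⊆ 𝔸^σ` is a normal variety: its coordinate ring
`ℂ[X i : i ∈ σ] / (f)` is an integrally closed domain. -/
def AffNormal {σ : Type} (f : MvPolynomial σ ℂ) : Prop :=
  IsDomain (MvPolynomial σ ℂ ⧸ Ideal.span {f}) ∧
  IsIntegrallyClosed (MvPolynomial σ ℂ ⧸ Ideal.span {f})

/-- `|f|^(-2c)` is locally integrable on `ℂ^k`; analytically, this says that the pair
`(𝔸^k, c · V(f))` is klt. -/
def AffKlt {k : ℕ} (f : MvPolynomial (Fin k) ℂ) (c : ℝ) : Prop :=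
  ∀ x : Fin k → ℂ, ∃ ε > 0,
    IntegrableOn (fun y : Fin k → ℂ => ‖eval y f‖ ^ (-2 * c)) (Metric.ball x ε) volume

/-- The affine hypersurface `V(f) ⊆ 𝔸^k` has rational singularities.  Since a hypersurface
is Gorenstein, this is equivalent to: `V(f)` is normal and has canonical (equivalently klt)
singularities, which by inversion of adjunction means that the pair `(𝔸^k, V(f))` is plt,
i.e. stays klt after a small decrease of the coefficient of `V(f)`. -/
def AffHasRationalSingularities {k : ℕ} (f : MvPolynomial (Fin k) ℂ) : Prop :=
  AffNormal f ∧ ∃ ε₀ : ℝ, 0 < ε₀ ∧ ∀ ε : ℝ, 0 < ε → ε ≤ ε₀ → AffKlt f (1 - ε)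

end AffineHyp

/-- Seidenberg: in characteristic zero, an associated prime of a differential ideal is
differential. -/
theorem Derivation.apply_mem_of_mem_iff_mul_mem {k D : Type*} [CommRing k] [CommRing D]
    [Algebra k D] [Algebra ℚ D] (d : Derivation k D D) {J Q : Ideal D} [hQp : Q.IsPrime]
    (hJ : ∀ x ∈ J, d x ∈ J) {v : D} (hQ : ∀ h, h ∈ Q ↔ h * v ∈ J) {N : ℕ}
    (hN : ∀ n, N ≤ n → d^[n] v = 0) {h : D} (hh : h ∈ Q) : d h ∈ Q := by
  let L : Ideal D :=
    { carrier := {w | ∃ s, s ∉ Q ∧ s * w ∈ J}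
      zero_mem' := ⟨1, Q.ne_top_iff_one.1 hQp.ne_top, by simp⟩
      add_mem' := by
        rintro a b ⟨s, hs, hsa⟩ ⟨t, ht, htb⟩
        refine ⟨s * t, hQp.mul_notMem hs ht, ?_⟩
        have := J.add_mem (J.mul_mem_left t hsa) (J.mul_mem_left s htb)
        convert this using 1
        ring
      smul_mem' := by
        rintro c a ⟨s, hs, hsa⟩
        refine ⟨s, hs, ?_⟩
        have := J.mul_mem_left c hsa
        rw [smul_eq_mul]
        convert this using 1
        ring }
  have hJL : J ≤ L := fun x hx => ⟨1, Q.ne_top_iff_one.1 hQp.ne_top, by simpa using hx⟩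
  have hdL : ∀ w ∈ L, d w ∈ L := by
    rintro w ⟨s, hs, hsw⟩
    refine ⟨s * s, hQp.mul_notMem hs hs, ?_⟩
    have h1 := J.mul_mem_left s (hJ _ hsw)
    rw [d.leibniz] at h1
    have := J.sub_mem h1 (J.mul_mem_left (d s) hsw)
    convert this using 1
    simp only [smul_eq_mul]
    ring
  have hLcancel : ∀ s w, s ∉ Q → s * w ∈ L → w ∈ L := by
    rintro s w hs ⟨t, ht, htw⟩
    exact ⟨t * s, hQp.mul_notMem ht hs, by rwa [mul_assoc]⟩
  have hvL : v ∉ L := by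
    rintro ⟨s, hs, hsv⟩
    exact hs ((hQ s).2 hsv)
  have hpow : ∀ n, h ^ (n + 1) * d^[n] v ∈ J := by
    intro n
    induction n with
    | zero => simpa using (hQ h).1 hh
    | succ n ih =>
      have h1 := J.mul_mem_left h (hJ _ ih)
      rw [d.leibniz, d.leibniz_pow] at h1
      have := J.sub_mem h1 (J.mul_mem_left ((n + 1 : ℕ) * d h) ih)
      rw [Function.iterate_succ_apply']
      convert this using 1
      simp only [smul_eq_mul, nsmul_eq_mul, Nat.add_sub_cancel]
      ring
  have hex : ∃ m, ∀ n, h ^ m * d^[n] v ∈ L := by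
    refine ⟨N, fun n => ?_⟩
    rcases le_or_gt N n with hn | hn
    · simp [hN n hn]
    · obtain ⟨c, rfl⟩ := Nat.exists_eq_add_of_lt hn
      have := hJL (J.mul_mem_left (h ^ c) (hpow n))
      convert this using 1
      ring
  classical
  have hspec := Nat.find_spec hex
  have hmin := fun m => Nat.find_min (H := hex) (m := m)
  rcases hm : Nat.find hex with _ | m
  · rw [hm] at hspec
    exact absurd (by simpa using hspec 0) hvL
  rw [hm] at hspec
  have := hmin m (by omega)
  push Not at this
  obtain ⟨n, hn⟩ := this
  by_contra hdh
  apply hn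
  apply hLcancel _ _ hdh
  have h1 := hdL _ (hspec n)
  rw [d.leibniz, d.leibniz_pow] at h1
  have h2 := hspec (n + 1)
  rw [Function.iterate_succ_apply'] at h2
  have h3 := L.mul_mem_left (algebraMap ℚ D (m + 1 : ℚ)⁻¹) (L.sub_mem h1 h2)
  have h4 : algebraMap ℚ D (m + 1 : ℚ)⁻¹ * ((m : D) + 1) = 1 := by
    have : ((m : D) + 1) = algebraMap ℚ D (m + 1) := by simp
    rw [this, ← map_mul, inv_mul_cancel₀ (by positivity), map_one]
  convert h3 using 1
  simp only [smul_eq_mul, nsmul_eq_mul, Nat.add_sub_cancel]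
  push_cast
  linear_combination (- (d h * (h ^ m * d^[n] v))) * h4

theorem IsIntegral.exists_pow_mul_eq_algebraMap {T R K : Type*} [CommRing T]
    [IsIntegrallyClosed T] [CommRing R] [IsDomain R] [Algebra T R] [Field K] [Algebra R K]
    [IsFractionRing R K] (hinj : Function.Injective (algebraMap T R)) {b : T} (hb : b ≠ 0)
    (h : ∀ r : R, ∃ (n : ℕ) (t : T), r * algebraMap T R b ^ n = algebraMap T R t) {x : K}
    (hx : IsIntegral R x) :
    ∃ (n : ℕ) (r : R), algebraMap R K (algebraMap T R b ^ n) * x = algebraMap R K r := by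
  have : IsDomain T := hinj.isDomain _
  have hb' : algebraMap T R b ≠ 0 := by simpa using hinj.ne hb
  let S := Localization.Away (algebraMap T R b)
  have hSle := powers_le_nonZeroDivisors_of_noZeroDivisors hb'
  have : IsDomain S := IsLocalization.isDomain_localization hSle
  have hRS : Function.Injective (algebraMap R S) := IsLocalization.injective S hSle
  have hT : IsLocalization.Away b S := by
    refine IsLocalization.Away.mk b ?_ (fun s => ?_) fun t u htu => ⟨0, ?_⟩
    · rw [IsScalarTower.algebraMap_apply T R S]
      exact IsLocalization.Away.algebraMap_isUnit _
    · obtain ⟨n, r, hr⟩ := IsLocalization.Away.surj (algebraMap T R b) s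
      obtain ⟨m, t, ht⟩ := h r
      refine ⟨n + m, t, ?_⟩
      rw [IsScalarTower.algebraMap_apply T R S, IsScalarTower.algebraMap_apply T R S, ← ht,
        pow_add, ← mul_assoc, hr, map_mul, map_pow]
    · rw [IsScalarTower.algebraMap_apply T R S, IsScalarTower.algebraMap_apply T R S] at htu
      rw [hinj (hRS htu)]
  have : IsIntegrallyClosed S :=
    isIntegrallyClosed_of_isLocalization S (Submonoid.powers b)
      (powers_le_nonZeroDivisors_of_noZeroDivisors hb)
  let φ : S →+* K := IsLocalization.Away.lift (algebraMap T R b) (g := algebraMap R K)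
    (by simpa using hb')
  let : Algebra S K := φ.toAlgebra
  have : IsScalarTower R S K := .of_algebraMap_eq fun r => by
    simp [RingHom.algebraMap_toAlgebra, φ]
  have : IsFractionRing S K :=
    IsFractionRing.isFractionRing_of_isDomain_of_isLocalization
      (Submonoid.powers (algebraMap T R b)) S K
  obtain ⟨s, rfl⟩ := IsIntegrallyClosed.isIntegral_iff.1 (hx.tower_top (A := S))
  obtain ⟨n, r, hr⟩ := IsLocalization.Away.surj (algebraMap T R b) s
  refine ⟨n, r, ?_⟩
  rw [IsScalarTower.algebraMap_apply R S K, IsScalarTower.algebraMap_apply R S K, ← hr,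
    map_mul, map_pow, mul_comm]

namespace MvPolynomial

variable {σ R : Type*} [CommRing R]

theorem notMem_vars_of_pderiv_eq_zero [IsDomain R] [CharZero R] {i : σ} {g : MvPolynomial σ R} (h : pderiv i g = 0) :
    i ∉ g.vars := by
  classical
  rw [mem_vars_iff_mem_support]
  rintro ⟨m, hm, hi⟩
  have hle : Finsupp.single i 1 ≤ m := by
    simpa [Nat.one_le_iff_ne_zero] using hi
  have := coeff_pderiv g (m - Finsupp.single i 1) (i := i)
  rw [h, coeff_zero, tsub_add_cancel_of_le hle, eq_comm, mul_eq_zero] at this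
  exact this.elim (mem_support_iff.1 hm) (Nat.cast_add_one_ne_zero _)

theorem totalDegree_pderiv_lt {i : σ} {g : MvPolynomial σ R} (h : pderiv i g ≠ 0) :
    (pderiv i g).totalDegree < g.totalDegree := by
  obtain ⟨m, hm, hmd⟩ := Finset.exists_mem_eq_sup (pderiv i g).support
    (support_nonempty.2 h) fun s => s.sum fun _ e => e
  have hm' : m + Finsupp.single i 1 ∈ g.support := by
    rw [mem_support_iff] at hm ⊢
    rw [coeff_pderiv] at hm
    exact left_ne_zero_of_mul hm
  have := le_totalDegree hm'
  rw [Finsupp.sum_add_index' (by simp) (by simp), Finsupp.sum_single_index rfl] at this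
  rw [totalDegree, hmd]
  omega

theorem iterate_pderiv_eq_zero (i : σ) (n : ℕ) (g : MvPolynomial σ R) (h : g.totalDegree < n) :
    (pderiv i)^[n] g = 0 := by
  induction n generalizing g with
  | zero => omega
  | succ n ih =>
    rw [Function.iterate_succ_apply]
    by_cases h0 : pderiv i g = 0
    · rw [h0, iterate_map_zero]
    · have := totalDegree_pderiv_lt h0
      exact ih _ (by omega)

/-- A proper ideal of a polynomial ring over a field of characteristic zero that is stable under
all partial derivatives vanishes. -/
theorem eq_bot_of_pderiv_mem {k : Type*} [Field k] [CharZero k] {Q : Ideal (MvPolynomial σ k)}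
    (hQ : Q ≠ ⊤) (h : ∀ i, ∀ g ∈ Q, pderiv i g ∈ Q) : Q = ⊥ := by
  rw [eq_bot_iff]
  suffices ∀ n, ∀ g ∈ Q, g.totalDegree < n → g = 0 from
    fun g hg => this _ g hg (Nat.lt_succ_self _)
  intro n
  induction n with
  | zero => simp
  | succ n ih =>
    intro g hg hn
    have hz : ∀ i, pderiv i g = 0 := fun i => by
      by_contra h0
      have := totalDegree_pderiv_lt h0
      exact h0 (ih _ (h i g hg) (by omega))
    have hv : g.vars = ∅ :=
      Finset.eq_empty_of_forall_notMem fun i => notMem_vars_of_pderiv_eq_zero (hz i)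
    rw [vars_eq_empty_iff_eq_C] at hv
    rw [hv] at hg ⊢
    by_contra h0
    have h1 : coeff 0 g ≠ 0 := fun h => h0 (by rw [h, C_0])
    exact hQ (Ideal.eq_top_of_isUnit_mem _ hg ((isUnit_iff_ne_zero.2 h1).map C))

theorem not_dvd_of_pderiv_ne_zero [IsDomain R] {i : σ} {f t : MvPolynomial σ R} (hf : pderiv i f ≠ 0)
    (ht : i ∉ t.vars) (ht0 : t ≠ 0) : ¬ f ∣ t := by
  rintro ⟨g, rfl⟩
  have h0 := mul_ne_zero_iff.1 ht0
  have hi : i ∈ f.vars := by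
    by_contra hi
    exact hf (pderiv_eq_zero_of_notMem_vars hi)
  rw [mem_vars_iff_degreeOf_ne_zero] at ht hi
  rw [degreeOf_mul_eq h0.1 h0.2] at ht
  omega

theorem exists_pow_mul_eq_of_isIntegral {k : Type*} [Field k] [CharZero k]
    {f : MvPolynomial σ k} [(Ideal.span {f}).IsPrime] {i : σ} (hi : pderiv i f ≠ 0)
    (hii : pderiv i (pderiv i f) = 0) {K : Type*} [Field K]
    [Algebra (MvPolynomial σ k ⧸ Ideal.span {f}) K]
    [IsFractionRing (MvPolynomial σ k ⧸ Ideal.span {f}) K] {x : K}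
    (hx : IsIntegral (MvPolynomial σ k ⧸ Ideal.span {f}) x) :
    ∃ (n : ℕ) (r : MvPolynomial σ k ⧸ Ideal.span {f}),
      algebraMap _ K (Ideal.Quotient.mk (Ideal.span {f}) (pderiv i f) ^ n) * x =
        algebraMap _ K r := by
  have hmem : ∀ {g : MvPolynomial σ k}, g ∈ supported k {i}ᶜ ↔ i ∉ g.vars := by
    simp [mem_supported, Set.subset_def]
  have hT : IsIntegrallyClosed (supported k ({i}ᶜ : Set σ)) :=
    .of_equiv (supportedEquivMvPolynomial ({i}ᶜ : Set σ)).symm.toRingEquiv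
  have hB := hmem.2 (notMem_vars_of_pderiv_eq_zero hii)
  have hA : f - X i * pderiv i f ∈ supported k ({i}ᶜ : Set σ) := by
    refine hmem.2 (notMem_vars_of_pderiv_eq_zero ?_)
    simp [hii]
  have hf : Ideal.Quotient.mk (Ideal.span {f}) f = 0 :=
    Ideal.Quotient.eq_zero_iff_mem.2 (Ideal.mem_span_singleton_self f)
  refine IsIntegral.exists_pow_mul_eq_algebraMap (T := supported k ({i}ᶜ : Set σ))
    (b := ⟨pderiv i f, hB⟩) ?_ (fun h => hi congr($h.1)) (fun r => ?_) hx
  · rw [injective_iff_map_eq_zero]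
    rintro ⟨t, ht⟩ h0
    by_contra ht0
    refine not_dvd_of_pderiv_ne_zero hi (hmem.1 ht) (fun h => ht0 (Subtype.ext h)) ?_
    exact Ideal.mem_span_singleton.1 (Ideal.Quotient.eq_zero_iff_mem.1 h0)
  · obtain ⟨p, rfl⟩ := Ideal.Quotient.mk_surjective r
    suffices ∃ n : ℕ, ∃ t ∈ supported k ({i}ᶜ : Set σ),
        Ideal.Quotient.mk (Ideal.span {f}) (p * pderiv i f ^ n) =
          Ideal.Quotient.mk (Ideal.span {f}) t by
      obtain ⟨n, t, ht, h⟩ := this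
      refine ⟨n, ⟨t, ht⟩, ?_⟩
      rw [map_mul, map_pow] at h
      exact h
    induction p using MvPolynomial.induction_on with
    | C a => exact ⟨0, C a, Subalgebra.algebraMap_mem _ a, by simp⟩
    | add p q hp hq =>
      obtain ⟨n, t, ht, h⟩ := hp
      obtain ⟨m, u, hu, h'⟩ := hq
      refine ⟨n + m, t * pderiv i f ^ m + u * pderiv i f ^ n,
        add_mem (mul_mem ht (pow_mem hB _)) (mul_mem hu (pow_mem hB _)), ?_⟩
      simp only [map_add, map_mul, map_pow] at h h' ⊢
      rw [← h, ← h']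
      ring
    | mul_X p j hp =>
      obtain ⟨n, t, ht, h⟩ := hp
      by_cases hj : j = i
      · subst hj
        refine ⟨n + 1, t * -(f - X j * pderiv j f), mul_mem ht (neg_mem hA), ?_⟩
        simp only [map_neg, map_sub, map_mul, map_pow, hf] at h ⊢
        rw [← h]
        ring
      · refine ⟨n, t * X j, mul_mem ht (X_mem_supported.2 hj), ?_⟩
        simp only [map_mul, map_pow] at h ⊢
        rw [← h]
        ring

end MvPolynomial

namespace AffineHyp

theorem IsSquarefreePoly.pderiv_pderiv_self {σ : Type} {f : MvPolynomial σ ℂ}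
    (hf : IsSquarefreePoly f) (i : σ) : pderiv i (pderiv i f) = 0 := by
  ext m
  rw [coeff_pderiv, coeff_pderiv, coeff_zero, notMem_support_iff.1, zero_mul, zero_mul]
  intro hm
  have := hf _ hm i
  simp at this

end AffineHyp

theorem MvPolynomial.pderiv_pderiv_comm {σ R : Type*} [CommRing R] (i j : σ)
    (f : MvPolynomial σ R) : pderiv i (pderiv j f) = pderiv j (pderiv i f) := by
  classical
  ext m
  simp only [coeff_pderiv]
  rw [add_right_comm]
  by_cases h : i = j
  · rw [h]
  · simp [h, Ne.symm h]
    ring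

/-- the hypersurface in `𝔸^k` defined by an irreducible square-free
polynomial is normal. -/
theorem normal_of_irreducible_squarefree
    (k : ℕ) (hk : 1 ≤ k) (f : MvPolynomial (Fin k) ℂ)
    (hsq : AffineHyp.IsSquarefreePoly f) (hirr : Irreducible f) :
    AffineHyp.AffNormal f := by
  have hprime : (Ideal.span {f}).IsPrime :=
    (Ideal.span_singleton_prime hirr.ne_zero).2 hirr.prime
  refine ⟨inferInstance, ?_⟩
  set R := MvPolynomial (Fin k) ℂ ⧸ Ideal.span {f}
  let K := FractionRing R
  let mk : MvPolynomial (Fin k) ℂ →+* R := Ideal.Quotient.mk (Ideal.span {f})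
  rw [isIntegrallyClosed_iff K]
  by_contra! hcon
  obtain ⟨x, hx, hxR⟩ := hcon
  let N : Submodule R (integralClosure R K) :=
    LinearMap.range (Algebra.linearMap R (integralClosure R K))
  have hN : ∀ y, y ∈ N ↔ ∃ r : R, algebraMap R K r = y := by
    intro y
    simp only [N, LinearMap.mem_range, Algebra.linearMap_apply, Subtype.ext_iff]
    rfl
  have hx0 : N.mkQ ⟨x, hx⟩ ≠ 0 := by
    rw [Submodule.mkQ_apply, Ne, Submodule.Quotient.mk_eq_zero, hN]
    exact fun ⟨r, hr⟩ => hxR r hr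
  obtain ⟨P, hP, -⟩ := exists_le_isAssociatedPrime_of_isNoetherianRing R _ hx0
  obtain ⟨hPp, y, hy⟩ := isAssociatedPrime_iff.1 hP
  obtain ⟨⟨y, hyint⟩, rfl⟩ := N.mkQ_surjective y
  have hPy : ∀ r, r ∈ P ↔ ∃ s, algebraMap R K s = algebraMap R K r * y := by
    intro r
    rw [hy, Submodule.mem_colon_singleton, Submodule.mem_bot, ← map_smul, Submodule.mkQ_apply,
      Submodule.Quotient.mk_eq_zero, hN]
    simp [Algebra.smul_def]
  let Q : Ideal (MvPolynomial (Fin k) ℂ) := P.comap mk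
  have hQp : Q.IsPrime := inferInstance
  have hfQ : f ∈ Q := by
    have : mk f = 0 := Ideal.Quotient.eq_zero_iff_mem.2 (Ideal.mem_span_singleton_self f)
    simp [Q, this]
  have hstable : ∀ i, ∀ g ∈ Q, pderiv i g ∈ Q := by
    intro i
    obtain ⟨j, hj, hij⟩ : ∃ j, pderiv j f ≠ 0 ∧ (pderiv i f = 0 ∨ i = j) := by
      by_cases hi : pderiv i f = 0
      · by_contra! h
        have hz : ∀ j, pderiv j f = 0 := fun j => by_contra fun hj => (h j hj).1 hi
        have hv : f.vars = ∅ :=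
          Finset.eq_empty_of_forall_notMem fun i => notMem_vars_of_pderiv_eq_zero (hz i)
        rw [vars_eq_empty_iff_eq_C] at hv
        have h1 : coeff 0 f ≠ 0 := fun h => hirr.ne_zero (by rw [hv, h, C_0])
        exact hirr.not_isUnit (hv ▸ (isUnit_iff_ne_zero.2 h1).map C)
      · exact ⟨i, hi, .inr rfl⟩
    set c := pderiv j f with hc
    have hjj : pderiv j c = 0 := hsq.pderiv_pderiv_self j
    have hic : pderiv i c = 0 := by
      rcases hij with hij | rfl
      · rw [hc, pderiv_pderiv_comm, hij, map_zero]
      · exact hjj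
    have hcf : mk c ≠ 0 := fun h =>
      not_dvd_of_pderiv_ne_zero hj (notMem_vars_of_pderiv_eq_zero hjj) hj
        (Ideal.mem_span_singleton.1 (Ideal.Quotient.eq_zero_iff_mem.1 h))
    have hcP : mk c ∈ P := by
      obtain ⟨n, r, hr⟩ := exists_pow_mul_eq_of_isIntegral hj hjj hyint
      exact hPp.mem_of_pow_mem n ((hPy _).2 ⟨r, hr.symm⟩)
    obtain ⟨s, hs⟩ := (hPy _).1 hcP
    obtain ⟨v, rfl⟩ := Ideal.Quotient.mk_surjective s
    have hcK : algebraMap R K (mk c) ≠ 0 := by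
      simpa using hcf
    have hQv : ∀ h, h ∈ Q ↔ h * v ∈ Ideal.span {f, c} := by
      intro h
      rw [Ideal.mem_comap, hPy, Ideal.mem_span_pair]
      constructor
      · rintro ⟨t, ht⟩
        obtain ⟨t, rfl⟩ := Ideal.Quotient.mk_surjective t
        have h1 : mk (h * v - t * c) = 0 := by
          apply IsFractionRing.injective R K
          rw [map_sub, map_sub, map_mul, map_mul, map_mul, map_mul, map_zero]
          erw [hs, ht]
          ring
        obtain ⟨a, ha⟩ := Ideal.mem_span_singleton.1 (Ideal.Quotient.eq_zero_iff_mem.1 h1)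
        exact ⟨a, t, by linear_combination -ha⟩
      · rintro ⟨a, b, hab⟩
        refine ⟨mk b, mul_left_cancel₀ hcK ?_⟩
        have h1 : mk h * mk v = mk b * mk c := by
          have : mk f = 0 := Ideal.Quotient.eq_zero_iff_mem.2 (Ideal.mem_span_singleton_self f)
          rw [← map_mul, ← hab, map_add, map_mul, map_mul, this, mul_zero, zero_add]
        have h2 := congr(algebraMap R K $h1)
        rw [map_mul, map_mul] at h2
        have hs' : algebraMap R K (mk v) = algebraMap R K (mk c) * y := hs
        linear_combination -h2 + algebraMap R K (mk h) * hs'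
    refine fun g hg => (pderiv i).apply_mem_of_mem_iff_mul_mem ?_ hQv
      (fun n hn => iterate_pderiv_eq_zero i n v hn) hg
    intro z hz
    obtain ⟨a, b, rfl⟩ := Ideal.mem_span_pair.1 hz
    have hif : pderiv i f ∈ Ideal.span {f, c} := by
      rcases hij with hij | rfl
      · simp [hij]
      · exact Ideal.subset_span (by simp [hc])
    have hf' : f ∈ Ideal.span {f, c} := Ideal.subset_span (by simp)
    have hc' : c ∈ Ideal.span {f, c} := Ideal.subset_span (by simp)
    simp only [map_add, pderiv_mul, hic, mul_zero, add_zero]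
    exact add_mem (add_mem (Ideal.mul_mem_left _ _ hf') (Ideal.mul_mem_left _ _ hif))
      (Ideal.mul_mem_left _ _ hc')
  have hbot := eq_bot_of_pderiv_mem hQp.ne_top hstable
  rw [hbot, Ideal.mem_bot] at hfQ
  exact hirr.ne_zero hfQ
end

section
/- Let $X = \prod_{i=1}^n \mathbb{P}^{m_i}$, $d \geq 1$, and let $D$ be a prime divisor on $X$ of multidegree $(d,d,\dots,d)$. Then the log canonical threshold satisfies $\mathrm{lct}(X,D) \geq 1/d$; moreover if $d \geq 2$ the inequality is strict. -/
open MvPolynomial MeasureTheory Metric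
open scoped LinearAlgebra.Projectivization

namespace MultiProj

variable {n : ℕ}

/-- Index type for the homogeneous coordinates on `∏ i, ℙ^(m i)`. -/
abbrev Idx (m : Fin n → ℕ) : Type := Σ i : Fin n, Fin (m i + 1)

/-- `F` is multihomogeneous of multidegree `a`: every monomial of `F` has degree `a i` in the
block of variables belonging to the `i`-th factor. -/
def IsMultiHomog (m : Fin n → ℕ) (F : MvPolynomial (Idx m) ℂ) (a : Fin n → ℕ) : Prop :=
  ∀ p ∈ F.support, ∀ i : Fin n, (∑ j : Fin (m i + 1), p ⟨i, j⟩) = a i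

/-- Dehomogenization of `F` in the standard affine chart where the `c i`-th homogeneous
coordinate of the `i`-th factor is set to `1`. -/
noncomputable def chart (m : Fin n → ℕ) (F : MvPolynomial (Idx m) ℂ)
    (c : ∀ i : Fin n, Fin (m i + 1)) : MvPolynomial (Idx m) ℂ :=
  aeval (fun v : Idx m => if v.2 = c v.1 then 1 else X v) F

/-- The points of `X = ∏ i, ℙ^(m i)` over `ℂ`. -/
def Pt (m : Fin n → ℕ) : Type := ∀ i : Fin n, ℙ ℂ (Fin (m i + 1) → ℂ)

noncomputable instance (V : Type*) [AddCommGroup V] [Module ℂ V] [TopologicalSpace V] :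
    TopologicalSpace (ℙ ℂ V) :=
  inferInstanceAs (TopologicalSpace (Quotient (projectivizationSetoid ℂ V)))

noncomputable instance (m : Fin n → ℕ) : TopologicalSpace (Pt m) :=
  inferInstanceAs (TopologicalSpace (∀ i : Fin n, ℙ ℂ (Fin (m i + 1) → ℂ)))

/-- The zero locus in `∏ i, ℙ^(m i)` of a multihomogeneous polynomial. -/
noncomputable def zeroLocus (m : Fin n → ℕ) (F : MvPolynomial (Idx m) ℂ) : Set (Pt m) :=
  {x | eval (fun v : Idx m => (x v.1).rep v.2) F = 0}

/-- The pair `(X, ∑ j, q j • {F j = 0})` is Kawamata log terminal: in every standard affine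
chart the function `∏ j |F j|^(-2 q j)` is locally integrable (the analytic characterization
of klt for effective pairs on a smooth variety). -/
def IsKltPair (m : Fin n → ℕ) {ι : Type} [Fintype ι] (F : ι → MvPolynomial (Idx m) ℂ)
    (q : ι → ℚ) : Prop :=
  ∀ c : ∀ i : Fin n, Fin (m i + 1), ∀ x : Idx m → ℂ, ∃ ε > 0,
    IntegrableOn
      (fun y : Idx m → ℂ => ∏ j, ‖eval y (chart m (F j) c)‖ ^ (-2 * (q j : ℝ)))
      (Metric.ball x ε) volume

/-- The pair `(X, Δ)` with `⌊Δ⌋` the prime divisor indexed by `j₀` is purely log terminal: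
the pair stays klt after decreasing the coefficient of the `j₀`-th component by any
sufficiently small positive rational. -/
def IsPltPair (m : Fin n → ℕ) {ι : Type} [Fintype ι] [DecidableEq ι]
    (F : ι → MvPolynomial (Idx m) ℂ) (q : ι → ℚ) (j₀ : ι) : Prop :=
  ∃ ε₀ : ℚ, 0 < ε₀ ∧ ∀ ε : ℚ, 0 < ε → ε ≤ ε₀ →
    IsKltPair m F (Function.update q j₀ (q j₀ - ε))

/-- The hypersurface `{F = 0}` in `∏ i, ℙ^(m i)` is normal: in each standard affine chart
meeting it, its coordinate ring is a normal domain. -/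
def IsNormalHypersurface (m : Fin n → ℕ) (F : MvPolynomial (Idx m) ℂ) : Prop :=
  ∀ c : ∀ i : Fin n, Fin (m i + 1), ¬ IsUnit (chart m F c) →
    IsDomain (MvPolynomial (Idx m) ℂ ⧸ Ideal.span {chart m F c}) ∧
    IsIntegrallyClosed (MvPolynomial (Idx m) ℂ ⧸ Ideal.span {chart m F c})


/-- Analytic log canonical threshold of the hypersurface `{F = 0}` in `∏ i, ℙ^(m i)`:
the supremum of the set of positive `c` for which `|F|^(-2c)` is locally integrable in
every standard affine chart. -/
noncomputable def lct (m : Fin n → ℕ) (F : MvPolynomial (Idx m) ℂ) : ℝ :=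
  sSup {c : ℝ | 0 < c ∧ ∀ cc : ∀ i : Fin n, Fin (m i + 1), ∀ x : Idx m → ℂ, ∃ ε > 0,
    IntegrableOn (fun y : Idx m → ℂ => ‖eval y (chart m F cc)‖ ^ (-2 * c))
      (Metric.ball x ε) volume}

/-- A (rational) divisor class of multidegree `b` on `∏ i, ℙ^(m i)` is ample: some positive
multiple `N • b` is integral and the multihomogeneous forms of multidegree `N • b`
separate the points of `X`. -/
def IsAmpleClass (m : Fin n → ℕ) (b : Fin n → ℚ) : Prop :=
  ∃ (N : ℕ) (b' : Fin n → ℕ), 0 < N ∧ (∀ i, (b' i : ℚ) = N * b i) ∧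
    ∀ x y : Pt m, x ≠ y → ∃ G : MvPolynomial (Idx m) ℂ, IsMultiHomog m G b' ∧
      eval (fun v : Idx m => (x v.1).rep v.2) G = 0 ∧
      eval (fun v : Idx m => (y v.1).rep v.2) G ≠ 0

/-- The hypersurface `D = {F = 0}` has rational singularities.  For a hypersurface `D` in the
smooth variety `X` (so `D` is Gorenstein), this is equivalent to: `D` is normal and the pair
`(X, D)` is plt (by inversion of adjunction, `D` is then klt, hence canonical, hence has
rational singularities). -/
def HasRationalSingularities (m : Fin n → ℕ) (F : MvPolynomial (Idx m) ℂ) : Prop :=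
  IsNormalHypersurface m F ∧ IsPltPair m (fun _ : Fin 1 => F) (fun _ => 1) 0

/-- The projection `∏ j, ℙ^(m j) → ∏_{j ≠ i} ℙ^(m j)` forgetting the `i`-th factor. -/
def projAway (m : Fin n → ℕ) (i : Fin n) (x : Pt m) :
    ∀ j : {j : Fin n // j ≠ i}, ℙ ℂ (Fin (m j.1 + 1) → ℂ) := fun j => x j.1

/-- `Wset m F i` is the set of points `z` of `∏_{j ≠ i} ℙ^(m j)` whose whole fiber under the
projection `π i` is contained in `{F = 0}`. -/
def Wset (m : Fin n → ℕ) (F : MvPolynomial (Idx m) ℂ) (i : Fin n) :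
    Set (∀ j : {j : Fin n // j ≠ i}, ℙ ℂ (Fin (m j.1 + 1) → ℂ)) :=
  {z | ∀ x : Pt m, projAway m i x = z → x ∈ zeroLocus m F}

/-- `x` is a smooth point of the hypersurface `{F = 0}`: some partial derivative of the
multihomogeneous form `F` does not vanish at (a representative of) `x`. -/
def IsSmoothPt (m : Fin n → ℕ) (F : MvPolynomial (Idx m) ℂ) (x : Pt m) : Prop :=
  ∃ v : Idx m, eval (fun w : Idx m => (x w.1).rep w.2) (pderiv v F) ≠ 0

end MultiProj


namespace PolyIntegrability

open scoped ENNReal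

section Preliminaries

/-- The negative powers of `‖t‖` of exponent less than `2` are integrable near `0` in `ℂ`. -/
lemma lintegral_closedBall_inv_enorm_rpow_lt_top {θ : ℝ} (hθ : θ < 2) (r : ℝ) :
    ∫⁻ t in closedBall (0 : ℂ) r, (‖t‖ₑ⁻¹) ^ θ < ∞ := by
  have hint : IntegrableOn (fun t : ℂ => ‖t‖ ^ (-θ)) (ball 0 (r + 1)) := by
    refine integrableOn_ball_of_norm_le_rpow (C := 1) (α := θ) (by simp) (by simpa using hθ)
      (ae_of_all _ fun x => ?_) ?_
    · rw [one_mul, Real.norm_of_nonneg (by positivity)]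
    · exact (measurable_norm.pow_const _).aestronglyMeasurable
  have hfin := hint.2
  refine lt_of_le_of_lt ?_ hfin
  refine (lintegral_mono_set
    (show closedBall (0 : ℂ) r ⊆ ball 0 (r + 1) from closedBall_subset_ball (by linarith))).trans ?_
  refine lintegral_mono_ae ?_
  have h0 : ∀ᵐ t : ℂ ∂(volume.restrict (ball 0 (r + 1))), t ≠ 0 :=
    ae_restrict_of_ae (Measure.ae_ne volume 0)
  filter_upwards [h0] with t ht
  have hp : 0 < ‖t‖ := norm_pos_iff.2 ht
  rw [Real.enorm_eq_ofReal (by positivity), ← ENNReal.ofReal_rpow_of_pos hp, ofReal_norm,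
    ENNReal.rpow_neg, ENNReal.inv_rpow]

/-- Uniform integrability on a disc of negative powers of normalized linear forms. -/
lemma exists_lintegral_linear_le {θ : ℝ} (h₀ : 0 ≤ θ) (hθ : θ < 2) {R : ℝ} (hR : 0 ≤ R) :
    ∃ K : ℝ≥0∞, K ≠ ∞ ∧ ∀ α β : ℂ, (‖α‖ = 1 ∨ ‖β‖ = 1) →
      ∫⁻ t in closedBall (0 : ℂ) R, (‖α * t - β‖ₑ⁻¹) ^ θ ≤ K := by
  set A : ℝ≥0∞ := ENNReal.ofReal (1 / (2 * (R + 1))) with hA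
  have hApos : A ≠ 0 := by
    rw [hA, ne_eq, ENNReal.ofReal_eq_zero, not_le]; positivity
  set V := volume (closedBall (0 : ℂ) R)
  have hV : V ≠ ∞ := measure_closedBall_lt_top.ne
  set J := ∫⁻ t in closedBall (0 : ℂ) 1, (‖t‖ₑ⁻¹) ^ θ
  have hJ : J ≠ ∞ := (lintegral_closedBall_inv_enorm_rpow_lt_top hθ 1).ne
  refine ⟨(A⁻¹) ^ θ * (J + V) + 2 ^ θ * V, ?_, fun α β h => ?_⟩
  · refine ENNReal.add_ne_top.2 ⟨ENNReal.mul_ne_top ?_ (ENNReal.add_ne_top.2 ⟨hJ, hV⟩),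
      ENNReal.mul_ne_top ?_ hV⟩
    · exact ENNReal.rpow_ne_top_of_nonneg h₀ (ENNReal.inv_ne_top.2 hApos)
    · exact ENNReal.rpow_ne_top_of_nonneg h₀ (by simp)
  rcases le_or_gt (1 / (2 * (R + 1))) ‖α‖ with hα | hα
  · have hα0 : α ≠ 0 := by
      rintro rfl
      have : 0 < 1 / (2 * (R + 1)) := by positivity
      simp only [norm_zero] at hα
      linarith
    refine le_trans ?_ le_self_add
    have hAα : A ≤ ‖α‖ₑ := by
      rw [← ofReal_norm]; exact ENNReal.ofReal_le_ofReal hα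
    set z := β / α
    have hpt : ∀ t ∈ closedBall (0 : ℂ) R, (‖α * t - β‖ₑ⁻¹) ^ θ ≤
        (A⁻¹) ^ θ * ((closedBall z 1).indicator (fun t => (‖t - z‖ₑ⁻¹) ^ θ) t + 1) := by
      intro t _
      have he : ‖α * t - β‖ₑ = ‖α‖ₑ * ‖t - z‖ₑ := by
        rw [← enorm_mul]; congr 1; simp only [z]; field_simp
      rw [he, ENNReal.mul_inv (Or.inr enorm_ne_top) (Or.inl enorm_ne_top),
        ENNReal.mul_rpow_of_nonneg _ _ h₀]
      refine mul_le_mul' (ENNReal.rpow_le_rpow (ENNReal.inv_le_inv.2 hAα) h₀) ?_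
      by_cases ht : t ∈ closedBall z 1
      · rw [Set.indicator_of_mem ht]; exact le_self_add
      · rw [Set.indicator_of_notMem ht, zero_add]
        refine ENNReal.rpow_le_one ?_ h₀
        rw [ENNReal.inv_le_one, ← ofReal_norm, ENNReal.one_le_ofReal]
        rw [mem_closedBall, dist_eq_norm] at ht
        linarith
    refine (setLIntegral_mono' measurableSet_closedBall hpt).trans ?_
    have hm : Measurable fun t : ℂ => (‖t - z‖ₑ⁻¹) ^ θ := by fun_prop
    rw [lintegral_const_mul' _ _
        (ENNReal.rpow_ne_top_of_nonneg h₀ (ENNReal.inv_ne_top.2 hApos)),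
      lintegral_add_right _ measurable_const]
    gcongr
    · refine (setLIntegral_le_lintegral _ _).trans ?_
      rw [lintegral_indicator measurableSet_closedBall]
      refine le_of_eq ?_
      have hmp := measurePreserving_sub_right (volume : Measure ℂ) z
      have := hmp.setLIntegral_comp_preimage (measurableSet_closedBall (x := (0 : ℂ)) (ε := 1))
        (f := fun t : ℂ => (‖t‖ₑ⁻¹) ^ θ) (by fun_prop)
      refine Eq.trans ?_ this
      congr 2
      ext t
      simp [dist_eq_norm]
    · simp [V]
  · have hβ : ‖β‖ = 1 := by
      refine h.resolve_left fun h1 => ?_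
      rw [h1, lt_div_iff₀ (by positivity)] at hα
      linarith
    refine le_trans ?_ le_add_self
    have hpt : ∀ t ∈ closedBall (0 : ℂ) R, (‖α * t - β‖ₑ⁻¹) ^ θ ≤ 2 ^ θ := by
      intro t ht
      refine ENNReal.rpow_le_rpow ?_ h₀
      rw [ENNReal.inv_le_iff_inv_le, ← ofReal_norm]
      rw [mem_closedBall_zero_iff] at ht
      have h1 : ‖α * t‖ ≤ 1 / 2 := by
        rw [norm_mul]
        calc ‖α‖ * ‖t‖ ≤ 1 / (2 * (R + 1)) * (R + 1) := by
              gcongr; linarith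
          _ = 1 / 2 := by field_simp
      have h2 : (1 / 2 : ℝ) ≤ ‖α * t - β‖ := by
        have := norm_sub_norm_le β (α * t)
        rw [norm_sub_rev] at this
        linarith
      calc (2 : ℝ≥0∞)⁻¹ = ENNReal.ofReal (1 / 2) := by
            rw [one_div, ENNReal.ofReal_inv_of_pos (by norm_num)]; simp
        _ ≤ _ := ENNReal.ofReal_le_ofReal h2
    refine (setLIntegral_mono' measurableSet_closedBall hpt).trans ?_
    simp [V]

/-- A polynomial of degree at most `d` is a multiple of a product of `d` normalized linear
forms. -/
lemma exists_eq_prod_linear (d : ℕ) (p : Polynomial ℂ) (hp : p.natDegree ≤ d) :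
    ∃ (μ : ℂ) (α β : Fin d → ℂ), (∀ i, ‖α i‖ ≤ 1 ∧ ‖β i‖ ≤ 1 ∧ (‖α i‖ = 1 ∨ ‖β i‖ = 1)) ∧
      p = Polynomial.C μ *
        ∏ i, (Polynomial.C (α i) * Polynomial.X - Polynomial.C (β i)) := by
  induction d generalizing p with
  | zero =>
    refine ⟨p.coeff 0, Fin.elim0, Fin.elim0, fun i => i.elim0, ?_⟩
    simpa using Polynomial.eq_C_of_natDegree_le_zero hp
  | succ d ih =>
    rcases Nat.lt_or_ge p.natDegree (d + 1) with h | h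
    · obtain ⟨μ, α, β, hab, he⟩ := ih p (by omega)
      refine ⟨μ, Fin.cons 0 α, Fin.cons (-1) β, ?_, ?_⟩
      · intro i
        refine Fin.cases ?_ (fun j => ?_) i
        · simp
        · simpa using hab j
      · rw [Fin.prod_univ_succ]
        simpa using he
    · have hdeg : p.degree ≠ 0 := fun h0 => by
        have := Polynomial.natDegree_eq_zero_iff_degree_le_zero.2 h0.le
        omega
      obtain ⟨z, hz⟩ := IsAlgClosed.exists_root p hdeg
      obtain ⟨q, hq⟩ := Polynomial.dvd_iff_isRoot.2 hz
      have hq0 : q ≠ 0 := by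
        rintro rfl
        rw [mul_zero] at hq
        rw [hq, Polynomial.natDegree_zero] at h
        omega
      have hqd : q.natDegree ≤ d := by
        rw [hq, Polynomial.natDegree_mul (Polynomial.X_sub_C_ne_zero z) hq0,
          Polynomial.natDegree_X_sub_C] at hp
        omega
      obtain ⟨μ, α, β, hab, he⟩ := ih q hqd
      set M : ℝ := max 1 ‖z‖ with hM
      have hM1 : 1 ≤ M := le_max_left _ _
      have hM0 : (M : ℂ) ≠ 0 := by
        have : M ≠ 0 := by linarith
        exact_mod_cast this
      have hMn : ‖(M : ℂ)‖ = M := by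
        rw [Complex.norm_real, Real.norm_of_nonneg (by linarith)]
      refine ⟨M * μ, Fin.cons ((M : ℂ)⁻¹) α, Fin.cons (z / M) β, ?_, ?_⟩
      · intro i
        refine Fin.cases ?_ (fun j => ?_) i
        · simp only [Fin.cons_zero, norm_inv, norm_div, hMn]
          refine ⟨inv_le_one_of_one_le₀ hM1, div_le_one_of_le₀ (le_max_right _ _) (by linarith), ?_⟩
          rcases le_total ‖z‖ 1 with h1 | h1
          · left; rw [hM, max_eq_left h1, inv_one]
          · right; rw [hM, max_eq_right h1, div_self (by linarith)]
        · simpa using hab j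
      · rw [Fin.prod_univ_succ, hq]
        simp only [Fin.cons_zero, Fin.cons_succ]
        conv_lhs => rw [he]
        have : (Polynomial.X - Polynomial.C z : Polynomial ℂ) = Polynomial.C (M : ℂ) *
            (Polynomial.C ((M : ℂ)⁻¹) * Polynomial.X - Polynomial.C (z / M)) := by
          rw [mul_sub, ← mul_assoc, ← Polynomial.C_mul, ← Polynomial.C_mul, mul_inv_cancel₀ hM0,
            mul_div_cancel₀ _ hM0, Polynomial.C_1, one_mul]
        rw [this, Polynomial.C_mul]
        ring

end Preliminaries

section OneVariable

lemma prod_rpow_le {d : ℕ} (w : Fin d → ℝ≥0∞) (j : Fin d) {s κ : ℝ} (hκ : 0 ≤ κ) (hs : κ ≤ s) :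
    ∏ i, w i ^ s ≤ w j ^ κ * ∑ i, w i ^ (s * d - κ) := by
  have hs0 : 0 ≤ s := hκ.trans hs
  obtain ⟨m, -, hm⟩ := Finset.exists_max_image Finset.univ w ⟨j, Finset.mem_univ j⟩
  have hd : 1 ≤ d := by have := j.2; omega
  rw [← Finset.mul_prod_erase Finset.univ _ (Finset.mem_univ j)]
  have h1 : w j ^ s = w j ^ κ * w j ^ (s - κ) := by
    rw [← ENNReal.rpow_add_of_nonneg _ _ hκ (by linarith)]; congr 1; ring
  have h2 : ∏ i ∈ Finset.univ.erase j, w i ^ s ≤ w m ^ (s * (d - 1)) := by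
    refine (Finset.prod_le_pow_card _ _ (w m ^ s) fun i _ =>
      ENNReal.rpow_le_rpow (hm i (Finset.mem_univ i)) hs0).trans (le_of_eq ?_)
    rw [Finset.card_erase_of_mem (Finset.mem_univ j), Finset.card_univ, Fintype.card_fin,
      ← ENNReal.rpow_natCast, ← ENNReal.rpow_mul, Nat.cast_sub hd, Nat.cast_one]
  have hd' : (0 : ℝ) ≤ d - 1 := by
    have : (1 : ℝ) ≤ d := by exact_mod_cast hd
    linarith
  calc w j ^ s * ∏ i ∈ Finset.univ.erase j, w i ^ s
      ≤ (w j ^ κ * w m ^ (s - κ)) * w m ^ (s * (d - 1)) := by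
        rw [h1]
        gcongr
        exact hm j (Finset.mem_univ j)
    _ = w j ^ κ * w m ^ (s * d - κ) := by
        rw [mul_assoc, ← ENNReal.rpow_add_of_nonneg _ _ (by linarith) (by positivity)]
        congr 2; ring
    _ ≤ _ := by
        gcongr
        exact Finset.single_le_sum (f := fun i => w i ^ (s * d - κ)) (fun _ _ => zero_le)
          (Finset.mem_univ m)

lemma inv_enorm_prod_rpow {ι : Type*} (S : Finset ι) (u : ι → ℂ) {s : ℝ} (hs : 0 ≤ s) :
    (‖∏ i ∈ S, u i‖ₑ⁻¹) ^ s = ∏ i ∈ S, (‖u i‖ₑ⁻¹) ^ s := by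
  classical
  induction S using Finset.induction_on with
  | empty => simp
  | insert a S ha ih =>
    rw [Finset.prod_insert ha, Finset.prod_insert ha, enorm_mul,
      ENNReal.mul_inv (Or.inr enorm_ne_top) (Or.inl enorm_ne_top),
      ENNReal.mul_rpow_of_nonneg _ _ hs, ih]

lemma exists_lintegral_prod_linear_le (d : ℕ) {s κ : ℝ} (hκ : 0 ≤ κ) (hs : κ ≤ s)
    (hsd : κ ≤ s * d) (hlt : s * d - κ < 2) {R : ℝ} (hR : 0 ≤ R) :
    ∃ K : ℝ≥0∞, K ≠ ∞ ∧ ∀ (μ : ℂ) (α β : Fin d → ℂ), (∀ i, ‖α i‖ = 1 ∨ ‖β i‖ = 1) →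
      ∀ W : ℝ≥0∞, (∀ t ∈ closedBall (0 : ℂ) R, ∃ j, ‖α j * t - β j‖ₑ⁻¹ ≤ W) →
      ∫⁻ t in closedBall (0 : ℂ) R, (‖μ * ∏ i, (α i * t - β i)‖ₑ⁻¹) ^ s ≤
        K * ((‖μ‖ₑ⁻¹) ^ s * W ^ κ) := by
  have hs0 : 0 ≤ s := hκ.trans hs
  obtain ⟨K, hK, hle⟩ := exists_lintegral_linear_le (by linarith : 0 ≤ s * d - κ) hlt hR
  refine ⟨d * K, ENNReal.mul_ne_top (by simp) hK, fun μ α β hab W hW => ?_⟩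
  calc ∫⁻ t in closedBall (0 : ℂ) R, (‖μ * ∏ i, (α i * t - β i)‖ₑ⁻¹) ^ s
      ≤ ∫⁻ t in closedBall (0 : ℂ) R, ((‖μ‖ₑ⁻¹) ^ s * W ^ κ) *
          ∑ i, (‖α i * t - β i‖ₑ⁻¹) ^ (s * d - κ) := by
        refine setLIntegral_mono' measurableSet_closedBall fun t ht => ?_
        obtain ⟨j, hj⟩ := hW t ht
        rw [enorm_mul, ENNReal.mul_inv (Or.inr enorm_ne_top) (Or.inl enorm_ne_top),
          ENNReal.mul_rpow_of_nonneg _ _ hs0, inv_enorm_prod_rpow _ _ hs0, mul_assoc]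
        gcongr
        refine (prod_rpow_le _ j hκ hs).trans ?_
        gcongr
    _ = ((‖μ‖ₑ⁻¹) ^ s * W ^ κ) *
          ∑ i, ∫⁻ t in closedBall (0 : ℂ) R, (‖α i * t - β i‖ₑ⁻¹) ^ (s * d - κ) := by
        rw [lintegral_const_mul _ (by fun_prop), lintegral_finsetSum _ (by fun_prop)]
    _ ≤ ((‖μ‖ₑ⁻¹) ^ s * W ^ κ) * ∑ _i : Fin d, K := by
        gcongr with i
        exact hle _ _ (hab i)
    _ = _ := by
        rw [Finset.sum_const, Finset.card_univ, Fintype.card_fin, nsmul_eq_mul, mul_comm]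

lemma inv_le_mul_inv {a b B : ℝ≥0∞} (hB : B ≠ 0) (hB' : B ≠ ∞) (h : a ≤ B * b) :
    b⁻¹ ≤ B * a⁻¹ := by
  have h1 : (B * b)⁻¹ ≤ a⁻¹ := ENNReal.inv_le_inv.2 h
  calc b⁻¹ = B * (B * b)⁻¹ := by
        rw [ENNReal.mul_inv (Or.inl hB) (Or.inl hB'), ← mul_assoc, ENNReal.mul_inv_cancel hB hB',
          one_mul]
    _ ≤ _ := by gcongr

lemma norm_linear_le {α β t : ℂ} (hα : ‖α‖ ≤ 1) (hβ : ‖β‖ ≤ 1) : ‖α * t - β‖ ≤ ‖t‖ + 1 := by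
  refine (norm_sub_le _ _).trans ?_
  rw [norm_mul]
  have := mul_le_of_le_one_left (norm_nonneg t) hα
  linarith

lemma prod_norm_le_pow_card {ι : Type*} (S : Finset ι) (u : ι → ℂ) {U : ℝ}
    (h : ∀ i ∈ S, ‖u i‖ ≤ U) : ∏ i ∈ S, ‖u i‖ ≤ U ^ S.card := by
  rw [← Finset.prod_const]
  exact Finset.prod_le_prod (fun _ _ => norm_nonneg _) h

lemma enorm_prod_linear_le {d : ℕ} (μ : ℂ) {α β : Fin d → ℂ} (hα : ∀ i, ‖α i‖ ≤ 1)
    (hβ : ∀ i, ‖β i‖ ≤ 1) (t : ℂ) :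
    ‖μ‖ₑ⁻¹ ≤ ENNReal.ofReal ((‖t‖ + 1) ^ d) * ‖μ * ∏ i, (α i * t - β i)‖ₑ⁻¹ := by
  have hpos : 0 < (‖t‖ + 1) ^ d := by positivity
  refine inv_le_mul_inv (by simpa using hpos) ENNReal.ofReal_ne_top ?_
  rw [← ofReal_norm, ← ofReal_norm, ← ENNReal.ofReal_mul hpos.le]
  refine ENNReal.ofReal_le_ofReal ?_
  rw [norm_mul, mul_comm, norm_prod]
  gcongr
  refine (prod_norm_le_pow_card _ _ fun i _ => norm_linear_le (hα i) (hβ i)).trans ?_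
  simp

/-- Integrability in one variable, uniform over polynomials of degree at most `d`. -/
lemma exists_lintegral_polynomial_le {d : ℕ} (hd : 1 ≤ d) {s : ℝ} (hs : 0 ≤ s) (hlt : s * d < 2)
    {R : ℝ} (hR : 0 ≤ R) (x₀ : ℂ) :
    ∃ K : ℝ≥0∞, K ≠ ∞ ∧ ∀ p : Polynomial ℂ, p.natDegree ≤ d →
      ∫⁻ t in closedBall (0 : ℂ) R, (‖p.eval t‖ₑ⁻¹) ^ s ≤ K * (‖p.eval x₀‖ₑ⁻¹) ^ s := by
  obtain ⟨K, hK, hle⟩ := exists_lintegral_prod_linear_le d le_rfl hs (by positivity)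
    (by simpa using hlt) hR
  refine ⟨K * ENNReal.ofReal ((‖x₀‖ + 1) ^ d) ^ s, ENNReal.mul_ne_top hK
    (ENNReal.rpow_ne_top_of_nonneg hs ENNReal.ofReal_ne_top), fun p hp => ?_⟩
  obtain ⟨μ, α, β, hab, rfl⟩ := exists_eq_prod_linear d p hp
  have hev : ∀ t : ℂ, (Polynomial.C μ * ∏ i, (Polynomial.C (α i) * Polynomial.X -
      Polynomial.C (β i))).eval t = μ * ∏ i, (α i * t - β i) := by
    intro t
    simp [Polynomial.eval_prod]
  simp only [hev]
  refine (hle μ α β (fun i => (hab i).2.2) ∞ fun t _ => ⟨⟨0, hd⟩, le_top⟩).trans ?_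
  rw [ENNReal.rpow_zero, mul_one, mul_assoc, ← ENNReal.mul_rpow_of_nonneg _ _ hs]
  gcongr
  exact enorm_prod_linear_le μ (fun i => (hab i).1) (fun i => (hab i).2.1) x₀

/-- A polynomial of degree `d` and its derivative are bounded by the largest linear factor. -/
lemma exists_norm_add_norm_derivative_le {d : ℕ} (hd : 2 ≤ d) {R : ℝ} (μ : ℂ)
    {α β : Fin d → ℂ} (hα : ∀ i, ‖α i‖ ≤ 1) (hβ : ∀ i, ‖β i‖ ≤ 1) {t : ℂ} (ht : ‖t‖ ≤ R) :
    ∃ j, ‖μ * ∏ i, (α i * t - β i)‖ + ‖(Polynomial.C μ * ∏ i, (Polynomial.C (α i) * Polynomial.X -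
      Polynomial.C (β i))).derivative.eval t‖ ≤
        (R + 1 + d) * (R + 1) ^ (d - 2) * ‖μ‖ * ‖α j * t - β j‖ := by
  obtain ⟨j, -, hj⟩ := Finset.exists_max_image Finset.univ (fun i => ‖α i * t - β i‖)
    ⟨⟨0, by omega⟩, Finset.mem_univ _⟩
  have hR : 0 ≤ R := (norm_nonneg t).trans ht
  set U := ‖α j * t - β j‖
  have hU0 : 0 ≤ U := norm_nonneg _
  have hU : U ≤ R + 1 := (norm_linear_le (hα j) (hβ j)).trans (by linarith)
  have hpow : U ^ (d - 1) ≤ (R + 1) ^ (d - 2) * U := by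
    rw [show d - 1 = (d - 2) + 1 by omega, pow_succ]
    gcongr
  refine ⟨j, ?_⟩
  have h1 : ‖μ * ∏ i, (α i * t - β i)‖ ≤ ‖μ‖ * ((R + 1) * ((R + 1) ^ (d - 2) * U)) := by
    rw [norm_mul, norm_prod]
    gcongr
    refine (prod_norm_le_pow_card _ _ fun i hi => hj i hi).trans ?_
    rw [Finset.card_univ, Fintype.card_fin]
    calc U ^ d = U * U ^ (d - 1) := by
          rw [← pow_succ', show d - 1 + 1 = d by omega]
      _ ≤ _ := by gcongr
  have h2 : ‖(Polynomial.C μ * ∏ i, (Polynomial.C (α i) * Polynomial.X -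
      Polynomial.C (β i))).derivative.eval t‖ ≤ ‖μ‖ * (d * ((R + 1) ^ (d - 2) * U)) := by
    rw [Polynomial.derivative_C_mul, Polynomial.eval_C_mul, norm_mul, Polynomial.derivative_prod_finset,
      Polynomial.eval_finsetSum]
    gcongr
    refine (norm_sum_le _ _).trans ?_
    refine (Finset.sum_le_card_nsmul _ _ ((R + 1) ^ (d - 2) * U) fun i _ => ?_).trans ?_
    · simp only [Polynomial.derivative_sub, Polynomial.derivative_mul, Polynomial.derivative_C,
        Polynomial.derivative_X, zero_mul, zero_add, mul_one, sub_zero, Polynomial.eval_mul,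
        Polynomial.eval_C, norm_mul, Polynomial.eval_prod, Polynomial.eval_sub, Polynomial.eval_X,
        norm_prod]
      calc _ ≤ U ^ (d - 1) * 1 := by
            gcongr
            · refine (prod_norm_le_pow_card _ _ fun i _ => hj i (Finset.mem_univ i)).trans ?_
              rw [Finset.card_erase_of_mem (Finset.mem_univ i), Finset.card_univ, Fintype.card_fin]
            · exact hα i
        _ ≤ _ := by rw [mul_one]; exact hpow
    · rw [Finset.card_univ, Fintype.card_fin, nsmul_eq_mul]
  calc _ ≤ ‖μ‖ * ((R + 1) * ((R + 1) ^ (d - 2) * U)) + ‖μ‖ * (d * ((R + 1) ^ (d - 2) * U)) :=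
        add_le_add h1 h2
    _ = _ := by ring

/-- The exponent in `exists_lintegral_polynomial_le` can exceed `2 / d`, at the price of a small
power of a lower bound `δ` for the polynomial together with its derivative. -/
lemma exists_lintegral_polynomial_le_of_derivative {d : ℕ} (hd : 2 ≤ d) {s κ : ℝ} (hκ : 0 < κ)
    (hs : κ ≤ s) (hlt : s * d - κ < 2) {R : ℝ} (hR : 0 ≤ R) (x₀ : ℂ) {A : ℝ} (hA : 0 < A) :
    ∃ K : ℝ≥0∞, K ≠ ∞ ∧ ∀ p : Polynomial ℂ, p.natDegree ≤ d → ∀ δ : ℂ,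
      (∀ t : ℂ, ‖t‖ ≤ R → ‖δ‖ ≤ A * (‖p.eval t‖ + ‖p.derivative.eval t‖)) →
      ∫⁻ t in closedBall (0 : ℂ) R, (‖p.eval t‖ₑ⁻¹) ^ s ≤
        K * ((‖p.eval x₀‖ₑ⁻¹) ^ (s - κ) * (‖δ‖ₑ⁻¹) ^ κ) := by
  have hs0 : 0 ≤ s := hκ.le.trans hs
  have hd1 : (1 : ℝ) ≤ d := by exact_mod_cast (by omega : 1 ≤ d)
  obtain ⟨K, hK, hle⟩ := exists_lintegral_prod_linear_le d hκ.le hs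
    (hs.trans (le_mul_of_one_le_right hs0 hd1)) hlt hR
  set A' : ℝ := A * ((R + 1 + d) * (R + 1) ^ (d - 2)) with hA'
  have hA'0 : 0 < A' := by positivity
  set B := ENNReal.ofReal ((‖x₀‖ + 1) ^ d)
  refine ⟨(K + 1) * (B ^ (s - κ) * ENNReal.ofReal A' ^ κ), ENNReal.mul_ne_top (by simpa using hK)
    (ENNReal.mul_ne_top
      (ENNReal.rpow_ne_top_of_nonneg (by linarith) ENNReal.ofReal_ne_top)
      (ENNReal.rpow_ne_top_of_nonneg hκ.le ENNReal.ofReal_ne_top)), fun p hp δ hδ => ?_⟩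
  have hB0 : B ≠ 0 := by simp only [B, ne_eq, ENNReal.ofReal_eq_zero, not_le]; positivity
  by_cases hδ0 : δ = 0
  · refine le_trans le_top (le_of_eq ?_)
    rw [hδ0, enorm_zero, ENNReal.inv_zero, ENNReal.top_rpow_of_pos hκ, ENNReal.mul_top,
      ENNReal.mul_top]
    · refine mul_ne_zero (by simp) (mul_ne_zero ?_ ?_)
      · exact (ENNReal.rpow_pos (pos_iff_ne_zero.2 hB0) ENNReal.ofReal_ne_top).ne'
      · exact (ENNReal.rpow_pos (by simpa using hA'0) ENNReal.ofReal_ne_top).ne'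
    · intro h
      rw [ENNReal.rpow_eq_zero_iff] at h
      rcases h with h | h
      · exact enorm_ne_top (ENNReal.inv_eq_zero.1 h.1)
      · linarith [h.2]
  obtain ⟨μ, α, β, hab, rfl⟩ := exists_eq_prod_linear d p hp
  have hev : ∀ t : ℂ, (Polynomial.C μ * ∏ i, (Polynomial.C (α i) * Polynomial.X -
      Polynomial.C (β i))).eval t = μ * ∏ i, (α i * t - β i) := by
    intro t
    simp [Polynomial.eval_prod]
  have hfac : ∀ t : ℂ, ‖t‖ ≤ R → ∃ j, ‖δ‖ ≤ A' * ‖μ‖ * ‖α j * t - β j‖ := by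
    intro t ht
    obtain ⟨j, hj⟩ := exists_norm_add_norm_derivative_le hd μ (fun i => (hab i).1)
      (fun i => (hab i).2.1) ht
    refine ⟨j, ((hδ t ht).trans (mul_le_mul_of_nonneg_left ((hev t).symm ▸ hj) hA.le)).trans
      (le_of_eq ?_)⟩
    rw [hA']; ring
  have hμ : μ ≠ 0 := by
    rintro rfl
    obtain ⟨j, hj⟩ := hfac 0 (by simpa using hR)
    simp only [norm_zero, mul_zero, zero_mul] at hj
    exact hδ0 (norm_le_zero_iff.1 hj)
  have hμe : ‖μ‖ₑ ≠ 0 := enorm_ne_zero.2 hμ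
  have hAe : ENNReal.ofReal A' ≠ 0 := by simpa using hA'0
  simp only [hev]
  refine (hle μ α β (fun i => (hab i).2.2) (ENNReal.ofReal A' * ‖μ‖ₑ * ‖δ‖ₑ⁻¹)
    fun t ht => ?_).trans ?_
  · obtain ⟨j, hj⟩ := hfac t (mem_closedBall_zero_iff.1 ht)
    refine ⟨j, inv_le_mul_inv (mul_ne_zero hAe hμe)
      (ENNReal.mul_ne_top ENNReal.ofReal_ne_top enorm_ne_top) ?_⟩
    rw [← ofReal_norm, ← ofReal_norm, ← ofReal_norm, ← ENNReal.ofReal_mul hA'0.le,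
      ← ENNReal.ofReal_mul (by positivity)]
    exact ENNReal.ofReal_le_ofReal hj
  · have h1 : (‖μ‖ₑ⁻¹) ^ s * (ENNReal.ofReal A' * ‖μ‖ₑ * ‖δ‖ₑ⁻¹) ^ κ =
        (‖μ‖ₑ⁻¹) ^ (s - κ) * ENNReal.ofReal A' ^ κ * (‖δ‖ₑ⁻¹) ^ κ := by
      rw [ENNReal.mul_rpow_of_nonneg _ _ hκ.le, ENNReal.mul_rpow_of_nonneg _ _ hκ.le,
        show s = (s - κ) + κ by ring, ENNReal.rpow_add_of_nonneg _ _ (by linarith) hκ.le,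
        add_sub_cancel_right]
      have : (‖μ‖ₑ⁻¹) ^ κ * ‖μ‖ₑ ^ κ = 1 := by
        rw [← ENNReal.mul_rpow_of_nonneg _ _ hκ.le, ENNReal.inv_mul_cancel hμe enorm_ne_top,
          ENNReal.one_rpow]
      calc _ = (‖μ‖ₑ⁻¹) ^ (s - κ) * ENNReal.ofReal A' ^ κ * (‖δ‖ₑ⁻¹) ^ κ *
            ((‖μ‖ₑ⁻¹) ^ κ * ‖μ‖ₑ ^ κ) := by ring
        _ = _ := by rw [this, mul_one]
    have h2 : (‖μ‖ₑ⁻¹) ^ (s - κ) ≤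
        B ^ (s - κ) * (‖μ * ∏ i, (α i * x₀ - β i)‖ₑ⁻¹) ^ (s - κ) := by
      rw [← ENNReal.mul_rpow_of_nonneg _ _ (by linarith)]
      exact ENNReal.rpow_le_rpow
        (enorm_prod_linear_le μ (fun i => (hab i).1) (fun i => (hab i).2.1) x₀) (by linarith)
    rw [h1]
    calc _ ≤ (K + 1) * (B ^ (s - κ) * (‖μ * ∏ i, (α i * x₀ - β i)‖ₑ⁻¹) ^ (s - κ) *
          ENNReal.ofReal A' ^ κ * (‖δ‖ₑ⁻¹) ^ κ) := by
          gcongr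
          exact le_self_add
      _ = _ := by ring

end OneVariable

section SeveralVariables

/-- The integral of `‖f‖ ^ (-s)` over the polydisc of radius `R`. -/
noncomputable def negPowIntegral {σ : Type*} [Fintype σ] (f : MvPolynomial σ ℂ) (s R : ℝ) : ℝ≥0∞ :=
  ∫⁻ y in closedBall (0 : σ → ℂ) R, (‖eval y f‖ₑ⁻¹) ^ s

/-- The restriction of `f` to every line parallel to a coordinate axis is a polynomial of degree at
most `d`. -/
def DegLE {σ : Type*} [DecidableEq σ] (f : MvPolynomial σ ℂ) (d : ℕ) : Prop :=
  ∀ (i : σ) (x : σ → ℂ), ∃ p : Polynomial ℂ, p.natDegree ≤ d ∧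
    ∀ t, p.eval t = eval (Function.update x i t) f

/-- Some nonzero polynomial `D` not involving the variable `i` is a combination of `f` and its
partial derivative with respect to that variable. -/
def SepAt {σ : Type*} [DecidableEq σ] (i : σ) (f : MvPolynomial σ ℂ) : Prop :=
  ∃ a b D : MvPolynomial σ ℂ, D ≠ 0 ∧ ∀ (x : σ → ℂ) (p : Polynomial ℂ),
    (∀ t, p.eval t = eval (Function.update x i t) f) → ∀ t,
      eval (Function.update x i t) a * p.eval t +
        eval (Function.update x i t) b * p.derivative.eval t = eval x D

lemma eval_aeval_apply {σ τ : Type*} (g : σ → MvPolynomial τ ℂ) (y : τ → ℂ)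
    (f : MvPolynomial σ ℂ) : eval y (aeval g f) = eval (fun i => eval y (g i)) f := by
  induction f using MvPolynomial.induction_on with
  | C a => simp
  | add p q hp hq => simp only [map_add, hp, hq]
  | mul_X p i hp => simp only [map_mul, hp, aeval_X, eval_X]

lemma exists_eval_ne_zero {σ : Type*} {f : MvPolynomial σ ℂ} (hf : f ≠ 0) :
    ∃ x, eval x f ≠ 0 := by
  by_contra! h
  exact hf (MvPolynomial.funext fun x => by simpa using h x)

lemma exists_restrict_line {σ : Type*} [DecidableEq σ] (f : MvPolynomial σ ℂ) (i : σ)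
    (x : σ → ℂ) : ∃ p : Polynomial ℂ, p.natDegree ≤ f.degreeOf i ∧
      ∀ t, p.eval t = eval (Function.update x i t) f := by
  refine ⟨∑ m ∈ f.support, Polynomial.C (f.coeff m * ∏ j ∈ m.support.erase i, x j ^ m j) *
    Polynomial.X ^ m i, ?_, fun t => ?_⟩
  · refine Polynomial.natDegree_sum_le_of_forall_le _ _ fun m hm => ?_
    refine (Polynomial.natDegree_C_mul_X_pow_le _ _).trans ?_
    exact degreeOf_le_iff.1 le_rfl m hm
  · rw [Polynomial.eval_finsetSum, eval_eq]
    refine Finset.sum_congr rfl fun m _ => ?_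
    simp only [Polynomial.eval_mul, Polynomial.eval_C, Polynomial.eval_pow, Polynomial.eval_X]
    rw [mul_assoc]
    congr 1
    have h1 : ∏ j ∈ m.support.erase i, Function.update x i t j ^ m j =
        ∏ j ∈ m.support.erase i, x j ^ m j :=
      Finset.prod_congr rfl fun j hj => by
        rw [Function.update_of_ne (Finset.ne_of_mem_erase hj)]
    by_cases hi : i ∈ m.support
    · rw [← Finset.mul_prod_erase _ _ hi, h1, Function.update_self, mul_comm]
    · rw [Finsupp.notMem_support_iff.1 hi, pow_zero, mul_one, ← h1, Finset.erase_eq_of_notMem hi]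

lemma DegLE.of_degreeOf {σ : Type*} [DecidableEq σ] {f : MvPolynomial σ ℂ} {d : ℕ}
    (h : ∀ i, f.degreeOf i ≤ d) : DegLE f d := fun i x => by
  obtain ⟨p, hp, he⟩ := exists_restrict_line f i x
  exact ⟨p, hp.trans (h i), he⟩

lemma exists_degLE {σ : Type*} [DecidableEq σ] (f : MvPolynomial σ ℂ) :
    ∃ d, 1 ≤ d ∧ DegLE f d :=
  ⟨f.totalDegree + 1, by omega,
    DegLE.of_degreeOf fun i => (degreeOf_le_totalDegree f i).trans (by omega)⟩

/-- Substitute the constant `x₀` for the first variable. -/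
noncomputable def specialize {n : ℕ} (x₀ : ℂ) :
    MvPolynomial (Fin (n + 1)) ℂ →ₐ[ℂ] MvPolynomial (Fin n) ℂ :=
  aeval (Fin.cons (C x₀) X)

@[simp]
lemma eval_specialize {n : ℕ} (x₀ : ℂ) (f : MvPolynomial (Fin (n + 1)) ℂ) (y : Fin n → ℂ) :
    eval y (specialize x₀ f) = eval (Fin.cons x₀ y) f := by
  rw [specialize, eval_aeval_apply]
  congr 2
  funext i
  refine Fin.cases ?_ (fun j => ?_) i <;> simp

lemma exists_specialize_ne_zero {n : ℕ} {f : MvPolynomial (Fin (n + 1)) ℂ} (hf : f ≠ 0) :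
    ∃ x₀, specialize x₀ f ≠ 0 := by
  obtain ⟨x, hx⟩ := exists_eval_ne_zero hf
  refine ⟨x 0, fun h => hx ?_⟩
  have := congrArg (eval (Fin.tail x)) h
  rwa [eval_specialize, Fin.cons_self_tail, map_zero] at this

lemma DegLE.specialize {n d : ℕ} {f : MvPolynomial (Fin (n + 1)) ℂ} (h : DegLE f d) (x₀ : ℂ) :
    DegLE (specialize x₀ f) d := fun i y => by
  obtain ⟨p, hp, he⟩ := h i.succ (Fin.cons x₀ y)
  refine ⟨p, hp, fun t => ?_⟩
  rw [he, eval_specialize, Fin.cons_update]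

lemma DegLE.exists_cons {n d : ℕ} {f : MvPolynomial (Fin (n + 1)) ℂ} (h : DegLE f d)
    (y : Fin n → ℂ) :
    ∃ p : Polynomial ℂ, p.natDegree ≤ d ∧ ∀ t, p.eval t = eval (Fin.cons t y) f := by
  obtain ⟨p, hp, he⟩ := h 0 (Fin.cons 0 y)
  exact ⟨p, hp, fun t => by rw [he, Fin.update_cons_zero]⟩

lemma measurable_inv_enorm_eval_rpow {σ : Type*} [Fintype σ] (f : MvPolynomial σ ℂ) (s : ℝ) :
    Measurable fun y : σ → ℂ => (‖eval y f‖ₑ⁻¹) ^ s := by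
  have : Measurable fun y : σ → ℂ => eval y f := (MvPolynomial.continuous_eval f).measurable
  fun_prop

/-- Tonelli's theorem on a polydisc. -/
lemma setLIntegral_closedBall_cons {n : ℕ} {g : (Fin (n + 1) → ℂ) → ℝ≥0∞} (hg : Measurable g)
    {R : ℝ} (hR : 0 ≤ R) :
    ∫⁻ x in closedBall (0 : Fin (n + 1) → ℂ) R, g x =
      ∫⁻ y in closedBall (0 : Fin n → ℂ) R, ∫⁻ t in closedBall (0 : ℂ) R, g (Fin.cons t y) := by
  have hmp := (volume_preserving_piFinSuccAbove (fun _ : Fin (n + 1) => ℂ) 0).symm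
  rw [← hmp.setLIntegral_comp_preimage measurableSet_closedBall hg]
  have hset : (MeasurableEquiv.piFinSuccAbove (fun _ : Fin (n + 1) => ℂ) 0).symm ⁻¹'
      closedBall 0 R = closedBall (0 : ℂ) R ×ˢ closedBall (0 : Fin n → ℂ) R := by
    ext ⟨t, y⟩
    simp only [Set.mem_preimage, mem_closedBall_zero_iff, Set.mem_prod, pi_norm_le_iff_of_nonneg hR]
    simp [Fin.forall_fin_succ, MeasurableEquiv.piFinSuccAbove]
  rw [hset]
  have hm : Measurable fun z : ℂ × (Fin n → ℂ) =>
      g ((MeasurableEquiv.piFinSuccAbove (fun _ : Fin (n + 1) => ℂ) 0).symm z) :=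
    hg.comp (MeasurableEquiv.measurable _)
  refine (setLIntegral_prod_symm _ hm.aemeasurable).trans ?_
  simp [MeasurableEquiv.piFinSuccAbove]
  rfl

lemma negPowIntegral_lt_top_of_isEmpty {σ : Type*} [Fintype σ] [IsEmpty σ] {f : MvPolynomial σ ℂ}
    (hf : f ≠ 0) {s : ℝ} (hs : 0 ≤ s) (R : ℝ) : negPowIntegral f s R < ∞ := by
  rw [eq_C_of_isEmpty f] at hf ⊢
  have h0 : coeff 0 f ≠ 0 := fun h => hf (by rw [h, C_0])
  simp only [negPowIntegral, eval_C, setLIntegral_const]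
  refine ENNReal.mul_lt_top (ENNReal.rpow_lt_top_of_nonneg hs ?_) measure_closedBall_lt_top
  simpa using h0

/-- A nonzero polynomial of degree at most `d` in each variable has log canonical threshold at
least `1 / d`. -/
theorem negPowIntegral_lt_top {n d : ℕ} (hd : 1 ≤ d) {f : MvPolynomial (Fin n) ℂ} (hf : f ≠ 0)
    (hdeg : DegLE f d) {s : ℝ} (hs : 0 ≤ s) (hlt : s * d < 2) {R : ℝ} (hR : 0 ≤ R) :
    negPowIntegral f s R < ∞ := by
  induction n with
  | zero => exact negPowIntegral_lt_top_of_isEmpty hf hs R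
  | succ n ih =>
    obtain ⟨x₀, hx₀⟩ := exists_specialize_ne_zero hf
    obtain ⟨K, hK, hle⟩ := exists_lintegral_polynomial_le hd hs hlt hR x₀
    rw [negPowIntegral, setLIntegral_closedBall_cons (measurable_inv_enorm_eval_rpow f s) hR]
    calc _ ≤ ∫⁻ y in closedBall (0 : Fin n → ℂ) R, K * (‖eval y (specialize x₀ f)‖ₑ⁻¹) ^ s := by
          refine lintegral_mono fun y => ?_
          obtain ⟨p, hp, he⟩ := hdeg.exists_cons y
          simpa only [he, eval_specialize] using hle p hp
      _ = K * negPowIntegral (specialize x₀ f) s R := lintegral_const_mul' _ _ hK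
      _ < ∞ := ENNReal.mul_lt_top hK.lt_top (ih hx₀ (hdeg.specialize x₀))

lemma rpow_mul_rpow_le_add {a b : ℝ≥0∞} {u v s q : ℝ} (hu : 0 ≤ u) (hv : 0 ≤ v) (hs : 0 < s)
    (hq : 0 < q) (h : u / s + v / q ≤ 1) : a ^ u * b ^ v ≤ 1 + (a ^ s + b ^ q) := by
  set z := 1 + (a ^ s + b ^ q) with hz
  have hz1 : 1 ≤ z := le_self_add
  have h1 : a ^ u ≤ z ^ (u / s) := by
    calc a ^ u = (a ^ s) ^ (u / s) := by
          rw [← ENNReal.rpow_mul]; congr 1; field_simp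
      _ ≤ _ := ENNReal.rpow_le_rpow (le_trans le_self_add le_add_self) (by positivity)
  have h2 : b ^ v ≤ z ^ (v / q) := by
    calc b ^ v = (b ^ q) ^ (v / q) := by
          rw [← ENNReal.rpow_mul]; congr 1; field_simp
      _ ≤ _ := ENNReal.rpow_le_rpow (le_trans le_add_self le_add_self) (by positivity)
  calc a ^ u * b ^ v ≤ z ^ (u / s) * z ^ (v / q) := mul_le_mul' h1 h2
    _ = z ^ (u / s + v / q) :=
        (ENNReal.rpow_add_of_nonneg _ _ (by positivity) (by positivity)).symm
    _ ≤ z ^ (1 : ℝ) := ENNReal.rpow_le_rpow_of_exponent_le hz1 h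
    _ = z := ENNReal.rpow_one z

lemma SepAt.specialize {n : ℕ} {f : MvPolynomial (Fin (n + 1)) ℂ} {i : Fin n}
    {a b D : MvPolynomial (Fin (n + 1)) ℂ} {x₀ : ℂ} (hD : specialize x₀ D ≠ 0)
    (h : ∀ (x : Fin (n + 1) → ℂ) (p : Polynomial ℂ),
      (∀ t, p.eval t = eval (Function.update x i.succ t) f) → ∀ t,
        eval (Function.update x i.succ t) a * p.eval t +
          eval (Function.update x i.succ t) b * p.derivative.eval t = eval x D) :
    SepAt i (specialize x₀ f) := by
  refine ⟨PolyIntegrability.specialize x₀ a, PolyIntegrability.specialize x₀ b,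
    PolyIntegrability.specialize x₀ D, hD, fun y p hp t => ?_⟩
  simp only [eval_specialize, Fin.cons_update] at hp ⊢
  exact h _ p hp t

lemma exists_norm_eval_le {σ : Type*} [Fintype σ] (f : MvPolynomial σ ℂ) (R : ℝ) :
    ∃ A : ℝ, 0 < A ∧ ∀ y : σ → ℂ, ‖y‖ ≤ R → ‖eval y f‖ ≤ A := by
  obtain ⟨A, hA⟩ := (isCompact_closedBall (0 : σ → ℂ) R).exists_bound_of_continuousOn
    (MvPolynomial.continuous_eval f).continuousOn
  exact ⟨max A 1, by positivity, fun y hy =>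
    (hA y (mem_closedBall_zero_iff.2 hy)).trans (le_max_left _ _)⟩

/-- A polynomial of degree at most `d` in each variable, with `d ≥ 2`, which is separable in each
variable has log canonical threshold greater than `1 / d`. -/
theorem exists_forall_negPowIntegral_lt_top {n d : ℕ} (hd : 2 ≤ d) {f : MvPolynomial (Fin n) ℂ}
    (hf : f ≠ 0) (hdeg : DegLE f d) (hsep : ∀ i, SepAt i f) :
    ∃ s : ℝ, 2 / (d : ℝ) < s ∧ ∀ R : ℝ, 0 ≤ R → negPowIntegral f s R < ∞ := by
  have hd2 : (2 : ℝ) ≤ d := by exact_mod_cast hd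
  have hd0 : (0 : ℝ) < d := by linarith
  induction n with
  | zero =>
    exact ⟨2 / d + 1, by linarith, fun R _ =>
      negPowIntegral_lt_top_of_isEmpty hf (by positivity) R⟩
  | succ n ih =>
    choose a b D hD hrel using hsep
    obtain ⟨x₀, hx₀⟩ := exists_specialize_ne_zero
      (mul_ne_zero hf (Finset.prod_ne_zero_iff.2 fun i (_ : i ∈ Finset.univ) => hD i))
    rw [map_mul, map_prod, mul_ne_zero_iff, Finset.prod_ne_zero_iff] at hx₀
    obtain ⟨hf₀, hD₀⟩ := hx₀
    obtain ⟨s', hs', hfin⟩ := ih hf₀ (hdeg.specialize x₀)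
      fun i => SepAt.specialize (hD₀ i.succ (Finset.mem_univ _)) (hrel i.succ)
    obtain ⟨e, he, hDe⟩ := exists_degLE (specialize x₀ (D 0))
    have he0 : (1 : ℝ) ≤ e := by exact_mod_cast he
    have hs'0 : 0 < s' := lt_trans (by positivity) hs'
    have hgap : 0 < 1 - 2 / d / s' := by
      rw [sub_pos, div_lt_one hs'0]; exact hs'
    set ε : ℝ := min ((1 - 2 / d / s') / (2 * d * e)) (1 / d ^ 2) with hε
    have hε0 : 0 < ε := by positivity
    have hε1 : 2 * d * e * ε ≤ 1 - 2 / d / s' := by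
      have := min_le_left ((1 - 2 / d / s') / (2 * d * e)) (1 / (d : ℝ) ^ 2)
      rw [← hε, le_div_iff₀ (by positivity)] at this
      linarith
    have hε2 : 2 * d * ε ≤ 2 / d := by
      have := min_le_right ((1 - 2 / d / s') / (2 * d * e)) (1 / (d : ℝ) ^ 2)
      rw [← hε, le_div_iff₀ (by positivity)] at this
      rw [le_div_iff₀ hd0]
      nlinarith
    set κ : ℝ := 2 * d * ε with hκ
    have hκ0 : 0 < κ := by positivity
    refine ⟨2 / d + ε, by linarith, fun R hR => ?_⟩
    obtain ⟨A, hA, ha⟩ := exists_norm_eval_le (a 0) R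
    obtain ⟨B, hB, hb⟩ := exists_norm_eval_le (b 0) R
    have hsd : (2 / d + ε) * d - κ < 2 := by
      have : (2 / d + ε) * d - κ = 2 - d * ε := by rw [hκ]; field_simp; ring
      rw [this]
      have : 0 < d * ε := by positivity
      linarith
    obtain ⟨K, hK, hle⟩ := exists_lintegral_polynomial_le_of_derivative hd hκ0
      (by linarith : κ ≤ 2 / d + ε) hsd hR x₀ (A := A + B) (by positivity)
    rw [negPowIntegral, setLIntegral_closedBall_cons (measurable_inv_enorm_eval_rpow f _) hR]
    have hexp : (2 / d + ε - κ) / s' + κ / (1 / e) ≤ 1 := by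
      have h1 : (2 / d + ε - κ) / s' ≤ 2 / d / s' := by
        gcongr
        nlinarith
      have h2 : κ / (1 / e) = 2 * d * e * ε := by rw [hκ]; field_simp
      linarith
    calc _ ≤ ∫⁻ y in closedBall (0 : Fin n → ℂ) R,
          K * (1 + ((‖eval y (specialize x₀ f)‖ₑ⁻¹) ^ s' +
            (‖eval y (specialize x₀ (D 0))‖ₑ⁻¹) ^ (1 / e : ℝ))) := by
          refine setLIntegral_mono' measurableSet_closedBall fun y hy => ?_
          rw [mem_closedBall_zero_iff] at hy
          obtain ⟨p, hp, hpe⟩ := hdeg.exists_cons y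
          have key := hle p hp (eval y (specialize x₀ (D 0))) fun t ht => ?_
          · simp only [hpe] at key
            refine key.trans ?_
            rw [← eval_specialize]
            gcongr
            exact rpow_mul_rpow_le_add (by linarith) hκ0.le hs'0 (by positivity) hexp
          · have hr := hrel 0 (Fin.cons x₀ y) p (fun t => by rw [hpe, Fin.update_cons_zero]) t
            rw [Fin.update_cons_zero] at hr
            have hc : ‖(Fin.cons t y : Fin (n + 1) → ℂ)‖ ≤ R := by
              rw [pi_norm_le_iff_of_nonneg hR]
              intro i
              refine Fin.cases ?_ (fun j => ?_) i
              · simpa using ht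
              · simpa using (norm_le_pi_norm y j).trans hy
            rw [eval_specialize, ← hr]
            refine (norm_add_le _ _).trans ?_
            rw [norm_mul, norm_mul]
            have h1 := mul_le_mul_of_nonneg_right (ha _ hc) (norm_nonneg (p.eval t))
            have h2 := mul_le_mul_of_nonneg_right (hb _ hc) (norm_nonneg (p.derivative.eval t))
            nlinarith [norm_nonneg (p.eval t), norm_nonneg (p.derivative.eval t)]
      _ = K * (volume (closedBall (0 : Fin n → ℂ) R) + (negPowIntegral (specialize x₀ f) s' R +
            negPowIntegral (specialize x₀ (D 0)) (1 / e) R)) := by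
          rw [lintegral_const_mul' _ _ hK, lintegral_add_left measurable_const,
            lintegral_add_left (measurable_inv_enorm_eval_rpow _ _), setLIntegral_const, one_mul]
          rfl
      _ < ∞ := by
          refine ENNReal.mul_lt_top hK.lt_top (ENNReal.add_lt_top.2 ⟨measure_closedBall_lt_top,
            ENNReal.add_lt_top.2 ⟨hfin R hR, ?_⟩⟩)
          refine negPowIntegral_lt_top he (hD₀ 0 (Finset.mem_univ _)) hDe (by positivity) ?_ hR
          rw [one_div, inv_mul_cancel₀ (by positivity)]
          norm_num

end SeveralVariables

section Separability

/-- A polynomial over a domain which is irreducible over the fraction field of characteristic zero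
generates, together with its derivative, an ideal containing a nonzero constant. -/
lemma exists_bezout_derivative_of_irreducible {A : Type*} [CommRing A] [IsDomain A]
    [IsGCDMonoid A] [CharZero A] {g : Polynomial A} (hg : Irreducible g)
    (hdeg : g.natDegree ≠ 0) :
    ∃ (a b : Polynomial A) (D : A), D ≠ 0 ∧
      a * g + b * Polynomial.derivative g = Polynomial.C D := by
  let K := FractionRing A
  have hinj : Function.Injective (algebraMap A K) := IsFractionRing.injective A K
  have : CharZero K := charZero_of_injective_algebraMap hinj
  obtain ⟨u, v, huv⟩ := ((hg.isPrimitive hdeg).irreducible_iff_irreducible_map_fraction_map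
    (K := K) |>.1 hg).separable
  obtain ⟨α, hα, hu⟩ := IsLocalization.integerNormalization_spec (nonZeroDivisors A) u
  obtain ⟨β, hβ, hv⟩ := IsLocalization.integerNormalization_spec (nonZeroDivisors A) v
  refine ⟨Polynomial.C β * IsLocalization.integerNormalization (nonZeroDivisors A) u,
    Polynomial.C α * IsLocalization.integerNormalization (nonZeroDivisors A) v, α * β,
    mul_ne_zero (nonZeroDivisors.ne_zero hα) (nonZeroDivisors.ne_zero hβ),
    Polynomial.map_injective _ hinj ?_⟩
  simp only [Polynomial.map_add, Polynomial.map_mul, Polynomial.map_C, hu, hv,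
    ← Polynomial.derivative_map, Algebra.smul_def, Polynomial.algebraMap_apply, map_mul]
  linear_combination (Polynomial.C (algebraMap A K α) * Polynomial.C (algebraMap A K β)) * huv

/-- An irreducible polynomial is separable in each variable. -/
lemma SepAt.of_irreducible {σ : Type*} [DecidableEq σ] {f : MvPolynomial σ ℂ}
    (hf : Irreducible f) (i : σ) : SepAt i f := by
  set e := Equiv.optionSubtypeNe i
  set E := optionEquivLeft ℂ {j // j ≠ i}
  have heval : ∀ (x : σ → ℂ) (t : ℂ) (h : Polynomial (MvPolynomial {j // j ≠ i} ℂ)),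
      eval (Function.update x i t) (rename e (E.symm h)) =
        (h.map (eval fun j : {j // j ≠ i} => x j)).eval t := by
    intro x t h
    have h1 := optionEquivLeft_elim_eval ℂ {j // j ≠ i} (fun j => x j) t (E.symm h)
    rw [AlgEquiv.apply_symm_apply] at h1
    rw [← h1, eval_rename]
    congr 2
    funext o
    cases o with
    | none => simp [e]
    | some j => simp [e, Function.update_of_ne j.2]
  set g := E (renameEquiv ℂ e.symm f) with hg
  have hfg : rename e (E.symm g) = f := by
    simp [hg, rename_rename]
  have hgirr : Irreducible g := by
    rw [hg, MulEquiv.irreducible_iff, MulEquiv.irreducible_iff]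
    exact hf
  have hpg : ∀ (x : σ → ℂ) (p : Polynomial ℂ),
      (∀ t, p.eval t = eval (Function.update x i t) f) →
        p = g.map (eval fun j : {j // j ≠ i} => x j) := fun x p hp =>
    Polynomial.funext fun t => by rw [hp, ← heval, hfg]
  by_cases hdeg : g.natDegree = 0
  · refine ⟨1, 0, f, hf.ne_zero, fun x p hp t => ?_⟩
    have h1 := hp (x i)
    rw [Function.update_eq_self] at h1
    rw [← h1, hpg x p hp, Polynomial.eq_C_of_natDegree_eq_zero hdeg]
    simp
  · have : IsGCDMonoid (MvPolynomial {j // j ≠ i} ℂ) := inferInstance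
    obtain ⟨a, b, D, hD, h⟩ := exists_bezout_derivative_of_irreducible hgirr hdeg
    refine ⟨rename e (E.symm a), rename e (E.symm b), rename Subtype.val D,
      (map_ne_zero_iff _ (rename_injective _ Subtype.val_injective)).2 hD, fun x p hp t => ?_⟩
    have h1 := congrArg (fun q => (q.map (eval fun j : {j // j ≠ i} => x j)).eval t) h
    simp only [Polynomial.map_add, Polynomial.map_mul, Polynomial.map_C, Polynomial.eval_add,
      Polynomial.eval_mul, Polynomial.eval_C, ← Polynomial.derivative_map] at h1
    rw [heval, heval, hpg x p hp, h1, eval_rename]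
    rfl

end Separability

section Charts

open MultiProj

variable {n : ℕ} {m : Fin n → ℕ}

/-- Replace by `1` the homogeneous coordinates selected by `c`. -/
def setOne (c : ∀ i, Fin (m i + 1)) (y : Idx m → ℂ) : Idx m → ℂ :=
  fun v => if v.2 = c v.1 then 1 else y v

lemma eval_chart (F : MvPolynomial (Idx m) ℂ) (c : ∀ i, Fin (m i + 1)) (y : Idx m → ℂ) :
    eval y (chart m F c) = eval (setOne c y) F := by
  rw [chart, eval_aeval_apply]
  congr 2
  funext v
  by_cases h : v.2 = c v.1 <;> simp [setOne, h]

lemma setOne_update_of_ne {c : ∀ i, Fin (m i + 1)} {v : Idx m} (hv : v.2 ≠ c v.1)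
    (y : Idx m → ℂ) (t : ℂ) :
    setOne c (Function.update y v t) = Function.update (setOne c y) v t := by
  funext u
  by_cases h : u = v
  · subst h; simp [setOne, hv]
  · simp [setOne, h]

lemma setOne_update_of_eq {c : ∀ i, Fin (m i + 1)} {v : Idx m} (hv : v.2 = c v.1)
    (y : Idx m → ℂ) (t : ℂ) : setOne c (Function.update y v t) = setOne c y := by
  funext u
  by_cases h : u = v
  · subst h; simp [setOne, hv]
  · simp [setOne, h]

lemma eval_scale {F : MvPolynomial (Idx m) ℂ} {d : ℕ} (hF : IsMultiHomog m F fun _ => d)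
    (l : Fin n → ℂ) (x : Idx m → ℂ) :
    eval (fun v => l v.1 * x v) F = (∏ i, l i) ^ d * eval x F := by
  rw [eval_eq', eval_eq', Finset.mul_sum]
  refine Finset.sum_congr rfl fun p hp => ?_
  have h : ∏ v : Idx m, l v.1 ^ p v = (∏ i, l i) ^ d := by
    rw [Fintype.prod_sigma, ← Finset.prod_pow]
    refine Finset.prod_congr rfl fun i _ => ?_
    exact (Finset.prod_pow_eq_pow_sum Finset.univ (fun j => p ⟨i, j⟩) (l i)).trans
      (congrArg (l i ^ ·) (hF p hp i))
  simp only [mul_pow, Finset.prod_mul_distrib, h]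
  ring

lemma degLE_of_isMultiHomog {F : MvPolynomial (Idx m) ℂ} {d : ℕ}
    (hF : IsMultiHomog m F fun _ => d) : DegLE F d := by
  refine DegLE.of_degreeOf fun v => degreeOf_le_iff.2 fun p hp => ?_
  exact (Finset.single_le_sum (f := fun j => p ⟨v.1, j⟩) (fun _ _ => Nat.zero_le _)
    (Finset.mem_univ v.2)).trans (hF p hp v.1).le

lemma DegLE.chart {F : MvPolynomial (Idx m) ℂ} {d : ℕ} (hF : DegLE F d)
    (c : ∀ i, Fin (m i + 1)) : DegLE (chart m F c) d := by
  intro v y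
  simp only [eval_chart]
  by_cases hv : v.2 = c v.1
  · exact ⟨Polynomial.C (eval (setOne c y) F), by simp, fun t => by
      rw [setOne_update_of_eq hv, Polynomial.eval_C]⟩
  · simpa only [setOne_update_of_ne hv] using hF v (setOne c y)

lemma exists_eval_ne_zero_and_forall_ne_zero {F : MvPolynomial (Idx m) ℂ} (hF : F ≠ 0)
    (c : ∀ i, Fin (m i + 1)) : ∃ w, eval w F ≠ 0 ∧ ∀ i, w ⟨i, c i⟩ ≠ 0 := by
  have h : F * ∏ i, X (⟨i, c i⟩ : Idx m) ≠ 0 :=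
    mul_ne_zero hF (Finset.prod_ne_zero_iff.2 fun i _ => X_ne_zero _)
  obtain ⟨w, hw⟩ := exists_eval_ne_zero h
  simp only [map_mul, map_prod, eval_X, mul_ne_zero_iff, Finset.prod_ne_zero_iff] at hw
  exact ⟨w, hw.1, fun i => hw.2 i (Finset.mem_univ i)⟩

lemma scale_setOne {c : ∀ i, Fin (m i + 1)} {w : Idx m → ℂ} (hw : ∀ i, w ⟨i, c i⟩ ≠ 0) :
    (fun v => w ⟨v.1, c v.1⟩ * setOne c (fun v => w v / w ⟨v.1, c v.1⟩) v) = w := by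
  funext ⟨i, j⟩
  by_cases h : j = c i
  · subst h; simp [setOne]
  · simp only [setOne, h, if_false]
    exact mul_div_cancel₀ _ (hw i)

lemma eval_eq_mul_eval_chart {F : MvPolynomial (Idx m) ℂ} {d : ℕ}
    (hF : IsMultiHomog m F fun _ => d) {c : ∀ i, Fin (m i + 1)} {w : Idx m → ℂ}
    (hw : ∀ i, w ⟨i, c i⟩ ≠ 0) :
    eval w F = (∏ i, w ⟨i, c i⟩) ^ d *
      eval (fun v => w v / w ⟨v.1, c v.1⟩) (chart m F c) := by
  rw [eval_chart, ← eval_scale hF, scale_setOne hw]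

lemma chart_ne_zero {F : MvPolynomial (Idx m) ℂ} (hF0 : F ≠ 0) {d : ℕ}
    (hF : IsMultiHomog m F fun _ => d) (c : ∀ i, Fin (m i + 1)) : chart m F c ≠ 0 := by
  obtain ⟨w, hw, hwc⟩ := exists_eval_ne_zero_and_forall_ne_zero hF0 c
  intro h
  rw [eval_eq_mul_eval_chart hF hwc, h, map_zero, mul_zero] at hw
  exact hw rfl

lemma SepAt.chart {F : MvPolynomial (Idx m) ℂ} (hF0 : F ≠ 0) {d : ℕ}
    (hF : IsMultiHomog m F fun _ => d) {v : Idx m} (h : SepAt v F) (c : ∀ i, Fin (m i + 1)) :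
    SepAt v (chart m F c) := by
  by_cases hv : v.2 = c v.1
  · refine ⟨1, 0, MultiProj.chart m F c, chart_ne_zero hF0 hF c, fun y p hp t => ?_⟩
    rw [hp, eval_chart, setOne_update_of_eq hv, eval_chart]
    simp
  obtain ⟨a, b, D, hD, hrel⟩ := h
  obtain ⟨w, hwD, hw⟩ := exists_eval_ne_zero_and_forall_ne_zero hD c
  set l : Fin n → ℂ := fun i => w ⟨i, c i⟩ with hl
  set κ : ℂ := (∏ i, l i) ^ d with hκ
  let ψ : MvPolynomial (Idx m) ℂ →ₐ[ℂ] MvPolynomial (Idx m) ℂ :=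
    aeval fun u => C (l u.1) * if u.2 = c u.1 then 1 else X u
  have hψ : ∀ (y : Idx m → ℂ) (G : MvPolynomial (Idx m) ℂ),
      eval y (ψ G) = eval (fun u => l u.1 * setOne c y u) G := by
    intro y G
    simp only [ψ]
    rw [eval_aeval_apply]
    congr 2
    funext u
    by_cases h : u.2 = c u.1 <;> simp [setOne, h]
  have hscale : ∀ (z : Idx m → ℂ) (t : ℂ), (fun u => l u.1 * Function.update z v t u) =
      Function.update (fun u => l u.1 * z u) v (l v.1 * t) := by
    intro z t
    funext u
    by_cases h : u = v
    · subst h; simp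
    · simp [h]
  refine ⟨ψ a * C κ, ψ b * C (κ * (l v.1)⁻¹), ψ D, fun h0 => hwD ?_, fun y p hp t => ?_⟩
  · have h1 := hψ (fun u => w u / w ⟨u.1, c u.1⟩) D
    rw [h0, map_zero, scale_setOne hw] at h1
    exact h1.symm
  · simp only [eval_chart, setOne_update_of_ne hv] at hp
    have h1 := hrel (fun u => l u.1 * setOne c y u)
      (Polynomial.C κ * p.comp (Polynomial.C (l v.1)⁻¹ * Polynomial.X)) (fun t => ?_) (l v.1 * t)
    · have h2 : (l v.1)⁻¹ * (l v.1 * t) = t := inv_mul_cancel_left₀ (hw v.1) t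
      simp only [Polynomial.derivative_mul, Polynomial.derivative_C, Polynomial.derivative_comp,
        Polynomial.derivative_X, Polynomial.eval_mul, Polynomial.eval_add, Polynomial.eval_C,
        Polynomial.eval_comp, Polynomial.eval_X, Polynomial.eval_zero, Polynomial.eval_one,
        h2] at h1
      rw [map_mul, map_mul, hψ, hψ, hψ, setOne_update_of_ne hv, hscale, eval_C, eval_C, ← h1]
      ring
    · simp only [Polynomial.eval_mul, Polynomial.eval_C, Polynomial.eval_comp, Polynomial.eval_X]
      rw [hp, hκ, ← eval_scale hF, hscale, mul_inv_cancel_left₀ (hw v.1)]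

end Charts

section FiniteType

variable {σ : Type*}

lemma DegLE.rename {τ : Type*} [DecidableEq σ] [DecidableEq τ] (e : σ ≃ τ) {f : MvPolynomial σ ℂ}
    {d : ℕ} (h : DegLE f d) : DegLE (rename e f) d := fun i x => by
  simpa only [eval_rename, Function.update_comp_equiv] using h (e.symm i) (x ∘ e)

lemma SepAt.rename {τ : Type*} [DecidableEq σ] [DecidableEq τ] (e : σ ≃ τ) {f : MvPolynomial σ ℂ}
    {i : τ} (h : SepAt (e.symm i) f) : SepAt i (rename e f) := by
  obtain ⟨a, b, D, hD, hrel⟩ := h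
  refine ⟨MvPolynomial.rename e a, MvPolynomial.rename e b, MvPolynomial.rename e D,
    (map_ne_zero_iff _ (rename_injective _ e.injective)).2 hD, fun x p hp t => ?_⟩
  simp only [eval_rename, Function.update_comp_equiv] at hp ⊢
  exact hrel _ p hp t

variable [Fintype σ]

lemma negPowIntegral_rename {τ : Type*} [Fintype τ] (e : σ ≃ τ) (f : MvPolynomial σ ℂ) (s : ℝ)
    {R : ℝ} (hR : 0 ≤ R) : negPowIntegral (rename e f) s R = negPowIntegral f s R := by
  have hmp := volume_measurePreserving_piCongrLeft (fun _ : σ => ℂ) e.symm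
  have happ : ∀ y : τ → ℂ, MeasurableEquiv.piCongrLeft (fun _ : σ => ℂ) e.symm y = y ∘ e := by
    intro y
    funext i
    simp [MeasurableEquiv.piCongrLeft, Equiv.piCongrLeft_apply]
  rw [negPowIntegral, negPowIntegral, ← hmp.setLIntegral_comp_preimage measurableSet_closedBall
    (measurable_inv_enorm_eval_rpow f s)]
  simp only [happ, eval_rename]
  congr 2
  ext y
  simp only [Set.mem_preimage, happ, mem_closedBall_zero_iff, pi_norm_le_iff_of_nonneg hR]
  exact e.forall_congr_right.symm

lemma negPowIntegral_lt_top_of_degLE [DecidableEq σ] {d : ℕ} (hd : 1 ≤ d)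
    {f : MvPolynomial σ ℂ} (hf : f ≠ 0) (hdeg : DegLE f d) {s : ℝ} (hs : 0 ≤ s)
    (hlt : s * d < 2) {R : ℝ} (hR : 0 ≤ R) : negPowIntegral f s R < ∞ := by
  let e := Fintype.equivFin σ
  rw [← negPowIntegral_rename e f s hR]
  exact negPowIntegral_lt_top hd ((map_ne_zero_iff _ (rename_injective _ e.injective)).2 hf)
    (hdeg.rename e) hs hlt hR

lemma exists_forall_negPowIntegral_lt_top_of_sepAt [DecidableEq σ] {d : ℕ} (hd : 2 ≤ d)
    {f : MvPolynomial σ ℂ} (hf : f ≠ 0) (hdeg : DegLE f d) (hsep : ∀ i, SepAt i f) :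
    ∃ s : ℝ, 2 / (d : ℝ) < s ∧ ∀ R : ℝ, 0 ≤ R → negPowIntegral f s R < ∞ := by
  let e := Fintype.equivFin σ
  obtain ⟨s, hs, h⟩ := exists_forall_negPowIntegral_lt_top hd
    ((map_ne_zero_iff _ (rename_injective _ e.injective)).2 hf) (hdeg.rename e)
    fun i => (hsep (e.symm i)).rename e
  exact ⟨s, hs, fun R hR => (negPowIntegral_rename e f s hR).symm.trans_lt (h R hR)⟩

lemma enorm_norm_rpow_neg_le (z : ℂ) {u s : ℝ} (hu : 0 < u) (hus : u ≤ s) :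
    ‖‖z‖ ^ (-u)‖ₑ ≤ 1 + (‖z‖ₑ⁻¹) ^ s := by
  rcases eq_or_ne z 0 with rfl | hz
  · rw [norm_zero, Real.zero_rpow (by linarith)]
    simp
  · have hz' : 0 < ‖z‖ := norm_pos_iff.2 hz
    rw [Real.enorm_of_nonneg (by positivity), ← ENNReal.ofReal_rpow_of_pos hz', ofReal_norm,
      ENNReal.rpow_neg, ← ENNReal.inv_rpow]
    rcases le_total (‖z‖ₑ⁻¹) 1 with h | h
    · exact (ENNReal.rpow_le_one h hu.le).trans le_self_add
    · exact (ENNReal.rpow_le_rpow_of_exponent_le h hus).trans le_add_self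

lemma ball_subset_closedBall_zero (x : σ → ℂ) (r : ℝ) :
    ball x r ⊆ closedBall 0 (‖x‖ + |r|) := by
  intro y hy
  rw [mem_closedBall_zero_iff]
  have h1 := norm_le_norm_add_norm_sub' y x
  have h2 : ‖y - x‖ < r := by rwa [← dist_eq_norm]
  have h3 := le_abs_self r
  linarith

lemma integrableOn_norm_eval_rpow {f : MvPolynomial σ ℂ} {s u : ℝ}
    (h : ∀ R : ℝ, 0 ≤ R → negPowIntegral f s R < ∞) (hu : 0 < u) (hus : u ≤ s) (x : σ → ℂ)
    (r : ℝ) : IntegrableOn (fun y => ‖eval y f‖ ^ (-u)) (ball x r) := by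
  have hm : Measurable fun y : σ → ℂ => eval y f := (MvPolynomial.continuous_eval f).measurable
  refine ⟨(hm.norm.pow_const _).aestronglyMeasurable, ?_⟩
  set R := ‖x‖ + |r|
  calc ∫⁻ y in ball x r, ‖‖eval y f‖ ^ (-u)‖ₑ
      ≤ ∫⁻ y in closedBall 0 R, (1 + (‖eval y f‖ₑ⁻¹) ^ s) :=
        (lintegral_mono_set (ball_subset_closedBall_zero x r)).trans
          (lintegral_mono fun y => enorm_norm_rpow_neg_le _ hu hus)
    _ = volume (closedBall (0 : σ → ℂ) R) + negPowIntegral f s R := by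
        rw [lintegral_add_left measurable_const, setLIntegral_const, one_mul]
        rfl
    _ < ∞ := ENNReal.add_lt_top.2 ⟨measure_closedBall_lt_top, h R (by positivity)⟩

/-- A nonzero polynomial does not vanish almost everywhere. -/
lemma ae_eval_ne_zero {f : MvPolynomial σ ℂ} (hf : f ≠ 0) (x : σ → ℂ) (r : ℝ) :
    ∀ᵐ y ∂(volume.restrict (ball x r)), eval y f ≠ 0 := by
  classical
  obtain ⟨d, hd, hdeg⟩ := exists_degLE f
  have hd0 : (0 : ℝ) < d := by exact_mod_cast hd
  have hfin : negPowIntegral f (1 / d) (‖x‖ + |r|) < ∞ :=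
    negPowIntegral_lt_top_of_degLE hd hf hdeg (by positivity)
      (by rw [one_div, inv_mul_cancel₀ hd0.ne']; norm_num) (by positivity)
  filter_upwards [ae_restrict_of_ae_restrict_of_subset (ball_subset_closedBall_zero x r)
    (ae_lt_top (measurable_inv_enorm_eval_rpow f _) hfin.ne)] with y hy h0
  rw [h0, enorm_zero, ENNReal.inv_zero, ENNReal.top_rpow_of_pos (by positivity)] at hy
  exact lt_irrefl _ hy

/-- A negative power of a polynomial which is integrable near a zero has a bounded exponent. -/
lemma le_finrank_of_integrableOn {f : MvPolynomial σ ℂ} (hf : f ≠ 0) {x : σ → ℂ}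
    (hx : eval x f = 0) {u ε : ℝ} (hε : 0 < ε)
    (hint : IntegrableOn (fun y => ‖eval y f‖ ^ (-u)) (ball x ε)) :
    u ≤ Module.finrank ℝ (σ → ℂ) := by
  by_contra! hu
  set M := Module.finrank ℝ (σ → ℂ)
  have hu0 : 0 < u := lt_of_le_of_lt (Nat.cast_nonneg _) hu
  obtain ⟨L, hL, hO⟩ :=
    ((AnalyticOnNhd.eval_mvPolynomial f) x trivial).differentiableAt.isBigO_sub.exists_pos
  rw [Asymptotics.isBigOWith_iff] at hO
  obtain ⟨δ, hδ, hball⟩ := Metric.eventually_nhds_iff.1 hO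
  set I := ∫ y in ball x ε, ‖eval y f‖ ^ (-u)
  set V := volume.real (ball (0 : σ → ℂ) 1)
  have hV : 0 < V := ENNReal.toReal_pos (measure_ball_pos _ _ one_pos).ne' measure_ball_lt_top.ne
  have hle : ∀ r : ℝ, 0 < r → r < min δ ε → r ^ ((M : ℝ) - u) ≤ I / (L ^ (-u) * V) := by
    intro r hr hrlt
    have hrδ := hrlt.trans_le (min_le_left _ _)
    have hrε := hrlt.trans_le (min_le_right _ _)
    have hvol : volume.real (ball x r) = r ^ M * V := by
      rw [measureReal_def, Measure.addHaar_ball_of_pos _ _ hr, ENNReal.toReal_mul,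
        ENNReal.toReal_ofReal (by positivity)]
      rfl
    have h1 : (L * r) ^ (-u) * (r ^ M * V) ≤ I := by
      calc (L * r) ^ (-u) * (r ^ M * V) = ∫ _ in ball x r, (L * r) ^ (-u) := by
            rw [setIntegral_const, hvol, smul_eq_mul, mul_comm]
        _ ≤ ∫ y in ball x r, ‖eval y f‖ ^ (-u) := by
            refine integral_mono_ae (integrableOn_const measure_ball_lt_top.ne)
              (hint.mono_set (ball_subset_ball hrε.le)) ?_
            filter_upwards [ae_eval_ne_zero hf x r, ae_restrict_mem measurableSet_ball] with y hy hyr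
            have h2 := hball (lt_trans hyr hrδ)
            rw [hx, sub_zero] at h2
            refine Real.rpow_le_rpow_of_nonpos (norm_pos_iff.2 hy) (h2.trans ?_) (by linarith)
            have h3 : ‖y - x‖ < r := by rwa [← dist_eq_norm]
            gcongr
        _ ≤ I := setIntegral_mono_set hint (ae_of_all _ fun y => by positivity)
            (ball_subset_ball hrε.le).eventuallyLE
    rw [le_div_iff₀ (by positivity), sub_eq_add_neg, Real.rpow_add hr, Real.rpow_natCast]
    rw [Real.mul_rpow hL.le hr.le] at h1
    linarith
  have ht := (tendsto_rpow_neg_nhdsGT_zero (sub_neg.2 hu)).eventually_gt_atTop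
    (I / (L ^ (-u) * V))
  have hr := Ioo_mem_nhdsGT (lt_min hδ hε)
  obtain ⟨r, h1, h2⟩ := (ht.and hr).exists
  exact absurd (hle r h2.1 h2.2) (not_le.2 h1)

end FiniteType

section Boundedness

open MultiProj

/-- A polynomial without zeros is constant. -/
lemma eval_eq_eval_of_forall_ne_zero {σ : Type*} {f : MvPolynomial σ ℂ}
    (hf : ∀ x, eval x f ≠ 0) (x y : σ → ℂ) : eval x f = eval y f := by
  set p : Polynomial ℂ := aeval (fun i => Polynomial.C (x i) +
    Polynomial.C (y i - x i) * Polynomial.X) f with hp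
  have hpe : ∀ t, p.eval t = eval (fun i => x i + (y i - x i) * t) f := by
    intro t
    rw [hp, ← Polynomial.coe_aeval_eq_eval, ← AlgHom.comp_apply, comp_aeval,
      ← MvPolynomial.coe_aeval_eq_eval]
    simp
  have hdeg : p.degree = 0 := by
    by_contra h
    obtain ⟨t, ht⟩ := IsAlgClosed.exists_root p h
    exact hf _ ((hpe t).symm.trans ht)
  have hc := Polynomial.eq_C_of_degree_eq_zero hdeg
  have h0 := hpe 0
  have h1 := hpe 1
  rw [hc, Polynomial.eval_C] at h0 h1
  simpa using h0.symm.trans h1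

/-- A hypersurface of positive multidegree meets one of the affine charts. -/
lemma exists_eval_chart_eq_zero {n : ℕ} (hn : 1 ≤ n) {m : Fin n → ℕ} (hm : ∀ i, 1 ≤ m i) {d : ℕ}
    (hd : 1 ≤ d) {F : MvPolynomial (Idx m) ℂ} (hF : IsMultiHomog m F fun _ => d) :
    ∃ (c : ∀ i, Fin (m i + 1)) (x : Idx m → ℂ), eval x (chart m F c) = 0 := by
  by_contra! h
  set c₀ : ∀ i, Fin (m i + 1) := fun _ => 0
  set G : MvPolynomial (Idx m) ℂ :=
    C (eval 0 (chart m F c₀)) * (∏ i, X (⟨i, c₀ i⟩ : Idx m)) ^ d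
  have hG : (F - G) * ∏ i, X (⟨i, c₀ i⟩ : Idx m) = 0 := by
    refine MvPolynomial.funext fun w => ?_
    rw [map_mul, map_sub, map_zero, mul_eq_zero, or_iff_not_imp_right]
    intro hw
    simp only [map_prod, eval_X, Finset.prod_eq_zero_iff, not_exists, not_and] at hw
    rw [eval_eq_mul_eval_chart hF fun i => hw i (Finset.mem_univ i),
      eval_eq_eval_of_forall_ne_zero (h c₀) _ 0]
    simp only [G, map_mul, map_pow, map_prod, eval_C, eval_X]
    ring
  have hFG : F = G := sub_eq_zero.1 ((mul_eq_zero.1 hG).resolve_right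
    (Finset.prod_ne_zero_iff.2 fun i _ => X_ne_zero _))
  refine h (fun i => Fin.last (m i)) 0 ?_
  rw [eval_chart, hFG]
  have hz : ∏ i, setOne (fun i => Fin.last (m i)) (0 : Idx m → ℂ) ⟨i, c₀ i⟩ = 0 := by
    refine Finset.prod_eq_zero (Finset.mem_univ (⟨0, hn⟩ : Fin n)) ?_
    have : c₀ ⟨0, hn⟩ ≠ Fin.last (m ⟨0, hn⟩) := by
      have := hm ⟨0, hn⟩
      simp only [c₀, ne_eq, Fin.ext_iff, Fin.val_zero, Fin.val_last]
      omega
    simp [setOne, this]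
  simp only [G, map_mul, map_pow, map_prod, eval_C, eval_X, hz]
  rw [zero_pow (by omega), mul_zero]

end Boundedness

end PolyIntegrability

/-- for a prime divisor `D` of multidegree `(d,...,d)` on `∏ i, ℙ^(m i)` one
has `lct(X, D) ≥ 1/d`, with strict inequality when `d ≥ 2`. -/
theorem lct_ge_one_div_d
    (n : ℕ) (hn : 1 ≤ n) (m : Fin n → ℕ) (hm : ∀ i, 1 ≤ m i) (d : ℕ) (hd : 1 ≤ d)
    (F : MvPolynomial (MultiProj.Idx m) ℂ)
    (hirr : Irreducible F)
    (hdeg : MultiProj.IsMultiHomog m F (fun _ => d)) :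
    (1 : ℝ) / d ≤ MultiProj.lct m F ∧ (2 ≤ d → (1 : ℝ) / d < MultiProj.lct m F) := by
  classical
  have hd0 : (0 : ℝ) < d := by exact_mod_cast hd
  have hchart := PolyIntegrability.chart_ne_zero hirr.ne_zero hdeg
  have hdegLE := (PolyIntegrability.degLE_of_isMultiHomog hdeg).chart
  unfold MultiProj.lct
  set S := {c : ℝ | 0 < c ∧ ∀ cc : ∀ i : Fin n, Fin (m i + 1), ∀ x : MultiProj.Idx m → ℂ, ∃ ε > 0,
    IntegrableOn (fun y : MultiProj.Idx m → ℂ => ‖eval y (MultiProj.chart m F cc)‖ ^ (-2 * c))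
      (ball x ε) volume}
  have hmem : ∀ s : ℝ, 0 < s → (∀ cc : ∀ i : Fin n, Fin (m i + 1), ∃ s', s ≤ s' ∧
      ∀ R : ℝ, 0 ≤ R → PolyIntegrability.negPowIntegral (MultiProj.chart m F cc) s' R < ⊤) →
      s / 2 ∈ S := by
    intro s hs h
    refine ⟨by positivity, fun cc x => ⟨1, one_pos, ?_⟩⟩
    obtain ⟨s', hss', hfin⟩ := h cc
    rw [show -2 * (s / 2) = -s by ring]
    exact PolyIntegrability.integrableOn_norm_eval_rpow hfin hs hss' x 1
  have hweak : ∀ c : ℝ, 0 < c → c < 1 / d → c ∈ S := by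
    intro c hc hlt
    rw [lt_div_iff₀ hd0] at hlt
    rw [show c = 2 * c / 2 by ring]
    exact hmem _ (by positivity) fun cc => ⟨2 * c, le_rfl, fun R hR =>
      PolyIntegrability.negPowIntegral_lt_top_of_degLE hd (hchart cc) (hdegLE cc) (by positivity)
        (by linarith) hR⟩
  have hbdd : BddAbove S := by
    obtain ⟨cc, x, hx⟩ := PolyIntegrability.exists_eval_chart_eq_zero hn hm hd hdeg
    refine ⟨Module.finrank ℝ (MultiProj.Idx m → ℂ), fun c hc => ?_⟩
    obtain ⟨ε, hε, hint⟩ := hc.2 cc x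
    rw [neg_mul] at hint
    have h1 := PolyIntegrability.le_finrank_of_integrableOn (hchart cc) hx hε hint
    have h2 := hc.1
    linarith
  refine ⟨?_, fun hd2 => ?_⟩
  · by_contra! hlt
    have hpos : 0 < sSup S := lt_of_lt_of_le (by positivity : (0 : ℝ) < 1 / d / 2)
      (le_csSup hbdd (hweak _ (by positivity) (half_lt_self (by positivity))))
    have hle := le_csSup hbdd
      (hweak ((sSup S + 1 / d) / 2) (by positivity) (by linarith))
    linarith
  · have hsep : ∀ cc v, PolyIntegrability.SepAt v (MultiProj.chart m F cc) := fun cc v =>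
      (PolyIntegrability.SepAt.of_irreducible hirr v).chart hirr.ne_zero hdeg cc
    choose s hs hfin using fun cc =>
      PolyIntegrability.exists_forall_negPowIntegral_lt_top_of_sepAt hd2 (hchart cc) (hdegLE cc)
        (hsep cc)
    obtain ⟨c₀, -, hmin⟩ := Finset.exists_min_image Finset.univ s Finset.univ_nonempty
    have hpos : 0 < s c₀ := lt_trans (by positivity) (hs c₀)
    have hle := le_csSup hbdd
      (hmem (s c₀) hpos fun cc => ⟨s cc, hmin cc (Finset.mem_univ cc), hfin cc⟩)
    have h1 := hs c₀
    have h2 : (2 : ℝ) / d = 2 * (1 / d) := by ring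
    linarith
end

section
/- Let $D$ be an irreducible divisor in $(\mathbb{P}^1)^n$ of multidegree $(1,1,\dots,1)$ (so $D$ is cut out by a multilinear form in the $n$ pairs of homogeneous coordinates), and let $\pi : (\mathbb{P}^1)^n \to \mathbb{P}^1$ be a projection onto one factor with $\dim \pi(D) > 0$. Then for every $x \in \mathbb{P}^1$ the fiber $D \cap \pi^{-1}(x)$ is connected, and the restriction $\pi|_D : D \to \mathbb{P}^1$ is surjective with connected fibers. -/
open MvPolynomial MeasureTheory Metric
open scoped LinearAlgebra.Projectivization

open Topology

/-- A closed subset of a product with compact first factor is connected as soon as the second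
factor and all the slices over it are. -/
theorem IsClosed.isConnected_of_isConnected_slices {X W : Type*} [TopologicalSpace X]
    [TopologicalSpace W] [CompactSpace X] [ConnectedSpace W] {Z : Set (X × W)} (hZ : IsClosed Z)
    (h : ∀ w, IsConnected {x | (x, w) ∈ Z}) : IsConnected Z := by
  let f : Z → W := fun z => z.1.2
  have hf : IsQuotientMap f := by
    refine IsClosedMap.isQuotientMap
      (isClosedMap_snd_of_compactSpace.comp hZ.isClosedEmbedding_subtypeVal.isClosedMap)
      (by fun_prop) fun w => ?_
    obtain ⟨x, hx⟩ := (h w).nonempty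
    exact ⟨⟨(x, w), hx⟩, rfl⟩
  have hfib : ∀ w, IsConnected (f ⁻¹' {w}) := fun w => by
    have := isConnected_iff_connectedSpace.1 (h w)
    convert isConnected_range (f := fun x : {x | (x, w) ∈ Z} => (⟨(x, w), x.2⟩ : Z))
      (by fun_prop) using 1
    ext ⟨⟨x, w'⟩, hz⟩
    simp only [f, Set.mem_preimage, Set.mem_singleton_iff, Set.mem_range, Subtype.exists,
      Subtype.mk.injEq, Prod.mk.injEq, Set.mem_ofPred_eq]
    grind
  have := hf.isCoinducing.isConnected_preimage_of_isClosed hfib isClosed_univ isConnected_univ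
  rw [Set.preimage_univ] at this
  simpa using this.image _ continuous_subtype_val.continuousOn

namespace Projectivization

section

variable {V : Type*} [AddCommGroup V] [Module ℂ V] [TopologicalSpace V]

theorem continuous_mk' : Continuous (Projectivization.mk' ℂ (V := V)) := continuous_quot_mk

theorem isOpenQuotientMap_mk' [ContinuousConstSMul ℂ V] :
    IsOpenQuotientMap (Projectivization.mk' ℂ (V := V)) := by
  refine ⟨Quotient.mk_surjective, continuous_mk', fun U hU => ?_⟩
  have : IsOpen (Projectivization.mk' ℂ ⁻¹' (Projectivization.mk' ℂ '' U)) := by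
    have h : Projectivization.mk' ℂ ⁻¹' (Projectivization.mk' ℂ '' U) =
        ⋃ a : ℂˣ, (fun v : {v : V // v ≠ 0} =>
          (⟨a • v.1, (smul_ne_zero_iff_ne a).2 v.2⟩ : {v : V // v ≠ 0})) ⁻¹' U := by
      ext v
      simp only [Set.mem_preimage, Set.mem_image, mk'_eq_mk, mk_eq_mk_iff, Set.mem_iUnion]
      constructor
      · rintro ⟨u, hu, a, ha⟩
        exact ⟨a, by simpa only [ha] using hu⟩
      · rintro ⟨a, ha⟩
        exact ⟨_, ha, a, rfl⟩
    rw [h]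
    exact isOpen_iUnion fun a => hU.preimage
      (Continuous.subtype_mk (continuous_subtype_val.const_smul (a : ℂ)) _)
  exact this

end

variable {V : Type*} [NormedAddCommGroup V] [NormedSpace ℂ V]

instance [FiniteDimensional ℂ V] : CompactSpace (ℙ ℂ V) := by
  have : ProperSpace V := FiniteDimensional.proper ℂ V
  let f : sphere (0 : V) 1 → ℙ ℂ V := fun v => mk' ℂ ⟨v, ne_zero_of_mem_unit_sphere v⟩
  have hf : Continuous f := continuous_mk'.comp (continuous_subtype_val.subtype_mk _)
  refine Function.Surjective.compactSpace hf fun p => ?_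
  have hp := p.rep_nonzero
  refine ⟨⟨((‖p.rep‖ : ℂ)⁻¹) • p.rep, by simp [norm_smul, hp]⟩, ?_⟩
  conv_rhs => rw [← p.mk_rep]
  exact (mk_eq_mk_iff' ℂ _ _ _ _).2 ⟨_, rfl⟩

/-- The projectivization of a subspace of positive dimension is connected. -/
theorem isConnected_setOf_rep_mem {K : Submodule ℂ V} (hK : 0 < Module.rank ℂ K) :
    IsConnected {p : ℙ ℂ V | p.rep ∈ K} := by
  have hr : 1 < Module.rank ℝ K := by
    rw [rank_real_of_complex]
    have : (1 : Cardinal) ≤ Module.rank ℂ K := Cardinal.one_le_iff_pos.2 hK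
    calc (1 : Cardinal) < 2 := by norm_num
      _ ≤ 2 * Module.rank ℂ K := le_mul_of_one_le_right (by simp) this
  have hc := isConnected_compl_singleton_of_one_lt_rank hr (0 : K)
  have := isConnected_iff_connectedSpace.1 hc
  let f : ({0}ᶜ : Set K) → ℙ ℂ V := fun v => mk' ℂ ⟨v.1, fun h => v.2 (Subtype.ext h)⟩
  have hf : Continuous f := continuous_mk'.comp
    ((continuous_subtype_val.comp continuous_subtype_val).subtype_mk _)
  convert isConnected_range hf using 1
  ext p
  constructor
  · intro hp
    exact ⟨⟨⟨p.rep, hp⟩, by simpa using p.rep_nonzero⟩, p.mk_rep⟩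
  · rintro ⟨v, rfl⟩
    obtain ⟨a, ha⟩ := exists_smul_eq_mk_rep ℂ (v.1 : V) fun h => v.2 (Subtype.ext h)
    change (mk ℂ (v.1 : V) _).rep ∈ K
    rw [← ha]
    exact K.smul_mem (a : ℂ) v.1.2

instance [Nontrivial V] : ConnectedSpace (ℙ ℂ V) := by
  have : IsConnected {p : ℙ ℂ V | p.rep ∈ (⊤ : Submodule ℂ V)} :=
    isConnected_setOf_rep_mem (by rw [rank_top]; exact rank_pos)
  rw [connectedSpace_iff_univ]
  simpa using this

end Projectivization

namespace MultiProj

variable {n : ℕ} {m : Fin n → ℕ} {F : MvPolynomial (Idx m) ℂ} {a : Fin n → ℕ}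

theorem IsMultiHomog.eval_smul (hF : IsMultiHomog m F a) (c : Fin n → ℂ) (v : Idx m → ℂ) :
    eval (fun w => c w.1 * v w) F = (∏ i, c i ^ a i) * eval v F := by
  rw [eval_eq', eval_eq', Finset.mul_sum]
  refine Finset.sum_congr rfl fun p hp => ?_
  have : ∏ w : Idx m, c w.1 ^ p w = ∏ i, c i ^ a i := by
    rw [Fintype.prod_sigma]
    exact Finset.prod_congr rfl fun i _ => by
      rw [← hF p hp i]
      exact Finset.prod_pow_eq_pow_sum Finset.univ _ (c i)
  simp_rw [mul_pow, Finset.prod_mul_distrib, this]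
  ring

/-- Membership in the zero locus can be tested on any choice of homogeneous coordinates. -/
theorem IsMultiHomog.mk_mem_zeroLocus_iff (hF : IsMultiHomog m F a)
    (v : ∀ i, {v : Fin (m i + 1) → ℂ // v ≠ 0}) :
    (fun i => Projectivization.mk' ℂ (v i) : Pt m) ∈ zeroLocus m F ↔
      eval (fun w : Idx m => (v w.1).1 w.2) F = 0 := by
  choose c hc using fun i => Projectivization.exists_smul_eq_mk_rep ℂ (v i).1 (v i).2
  have h : eval (fun w : Idx m => (Projectivization.mk' ℂ (v w.1)).rep w.2) F =
      (∏ i, (c i : ℂ) ^ a i) * eval (fun w : Idx m => (v w.1).1 w.2) F := by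
    rw [← hF.eval_smul]
    congr! 2
    funext w
    rw [Projectivization.mk'_eq_mk, ← hc]
    rfl
  change eval (fun w : Idx m => (Projectivization.mk' ℂ (v w.1)).rep w.2) F = 0 ↔ _
  rw [h, mul_eq_zero, or_iff_right]
  simp [Finset.prod_eq_zero_iff]

theorem IsMultiHomog.isClosed_zeroLocus (hF : IsMultiHomog m F a) :
    IsClosed (zeroLocus m F) := by
  have hq : IsOpenQuotientMap (Pi.map fun i : Fin n =>
      Projectivization.mk' ℂ (V := Fin (m i + 1) → ℂ)) :=
    .piMap fun i => Projectivization.isOpenQuotientMap_mk'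
  refine hq.isQuotientMap.isClosed_preimage.1 ?_
  have : Pi.map (fun i : Fin n => Projectivization.mk' ℂ (V := Fin (m i + 1) → ℂ)) ⁻¹'
      zeroLocus m F = {v | eval (fun w : Idx m => (v w.1).1 w.2) F = 0} :=
    Set.ext hF.mk_mem_zeroLocus_iff
  rw [this]
  refine isClosed_eq ((MvPolynomial.continuous_eval F).comp ?_) continuous_const
  exact continuous_pi fun w => (continuous_apply w.2).comp
    (continuous_subtype_val.comp (continuous_apply w.1))

/-- A form of degree `1` in the `j`-th block of variables is linear in that block. -/
theorem IsMultiHomog.exists_linear (hF : IsMultiHomog m F a) {j : Fin n} (hj : a j = 1)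
    (u : ∀ i, Fin (m i + 1) → ℂ) :
    ∃ L : (Fin (m j + 1) → ℂ) →ₗ[ℂ] ℂ, ∀ v,
      eval (fun w : Idx m => Function.update u j v w.1 w.2) F = L v := by
  have key : ∀ p ∈ F.support, ∃ k : Fin (m j + 1), ∀ l, p ⟨j, l⟩ = if l = k then 1 else 0 := by
    intro p hp
    have hs := (hF p hp j).trans hj
    obtain ⟨k, -, hk⟩ := Finset.exists_ne_zero_of_sum_ne_zero (hs.trans_ne one_ne_zero)
    rw [← Finset.add_sum_erase _ _ (Finset.mem_univ k)] at hs
    have h0 : ∑ l ∈ Finset.univ.erase k, p ⟨j, l⟩ = 0 := by omega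
    refine ⟨k, fun l => ?_⟩
    split_ifs with hl
    · subst hl
      omega
    · exact Finset.sum_eq_zero_iff.1 h0 l (by simpa using hl)
  choose! k hk using key
  refine ⟨∑ p ∈ F.support, (F.coeff p * ∏ i ∈ {j}ᶜ, ∏ l, u i l ^ p ⟨i, l⟩) •
    LinearMap.proj (k p), fun v => ?_⟩
  rw [eval_eq', LinearMap.sum_apply]
  refine Finset.sum_congr rfl fun p hp => ?_
  rw [Fintype.prod_sigma, ← Finset.prod_mul_prod_compl {j}, Finset.prod_singleton]
  have h1 : ∏ l, Function.update u j v j l ^ p ⟨j, l⟩ = v (k p) := by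
    simp [hk p hp]
  have h2 : ∏ i ∈ {j}ᶜ, ∏ l, Function.update u j v i l ^ p ⟨i, l⟩ =
      ∏ i ∈ {j}ᶜ, ∏ l, u i l ^ p ⟨i, l⟩ :=
    Finset.prod_congr rfl fun i hi => by
      rw [Function.update_of_ne (by simpa using hi)]
  rw [h1, h2]
  simp
  ring

/-- The lines in the `j`-th direction meet the hypersurface in connected sets. -/
theorem IsMultiHomog.isConnected_line (hF : IsMultiHomog m F a) {j : Fin n} (hj : a j = 1)
    (hm : 1 ≤ m j) (x : ∀ i, ℙ ℂ (Fin (m i + 1) → ℂ)) :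
    IsConnected {p | (Function.update x j p : Pt m) ∈ zeroLocus m F} := by
  obtain ⟨L, hL⟩ := hF.exists_linear hj fun i => (x i).rep
  convert Projectivization.isConnected_setOf_rep_mem (K := L.ker) ?_ using 1
  · ext p
    rw [Set.mem_ofPred_eq, Set.mem_ofPred_eq, LinearMap.mem_ker, ← hL]
    change eval _ F = 0 ↔ _
    congr! 3
    funext w
    rcases eq_or_ne w.1 j with h | h
    · obtain ⟨i, l⟩ := w
      subst h
      simp
    · simp [h]
  · rw [rank_pos_iff_nontrivial, Submodule.nontrivial_iff_ne_bot]
    exact LinearMap.ker_ne_bot_of_finrank_lt (by simp; omega)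

theorem IsMultiHomog.isConnected_fiber (hF : IsMultiHomog m F a) {i j : Fin n} (hij : j ≠ i)
    (hj : a j = 1) (hm : ∀ i, 1 ≤ m i) (q : ℙ ℂ (Fin (m i + 1) → ℂ)) :
    IsConnected (zeroLocus m F ∩ (fun x : Pt m => x i) ⁻¹' {q}) := by
  let g : ℙ ℂ (Fin (m j + 1) → ℂ) × (∀ i, ℙ ℂ (Fin (m i + 1) → ℂ)) → Pt m :=
    fun z => Function.update (Function.update z.2 i q) j z.1
  have hg : Continuous g :=
    (continuous_snd.update i continuous_const).update j continuous_fst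
  have : IsConnected (g ⁻¹' zeroLocus m F) :=
    (hF.isClosed_zeroLocus.preimage hg).isConnected_of_isConnected_slices fun w =>
      hF.isConnected_line hj (hm j) (Function.update w i q)
  convert this.image g hg.continuousOn using 1
  rw [Set.image_preimage_eq_inter_range]
  congr 1
  ext x
  constructor
  · rintro rfl
    refine ⟨(x j, x), ?_⟩
    change Function.update (Function.update x i (x i)) j (x j) = x
    rw [Function.update_eq_self i x, Function.update_eq_self j x]
  · rintro ⟨z, rfl⟩
    change Function.update (Function.update z.2 i q) j z.1 i = q
    simp [hij.symm]

/-- A nonzero form of degree `1` on a single projective line vanishes at finitely many points. -/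
theorem IsMultiHomog.exists_ne_of_infinite (hF : IsMultiHomog m F a) (hF0 : F ≠ 0) {j : Fin n}
    (hj : a j = 1) (hm : m j = 1) (h : ((fun x : Pt m => x j) '' zeroLocus m F).Infinite) :
    ∃ i, i ≠ j := by
  by_contra! hn
  obtain ⟨L, hL⟩ := hF.exists_linear hj 0
  have hup : ∀ u : ∀ i, Fin (m i + 1) → ℂ, Function.update (0 : ∀ i, Fin (m i + 1) → ℂ) j (u j) = u := fun u => by
    ext i l
    obtain rfl := hn i
    simp
  have hz : ∀ x : Pt m, x ∈ zeroLocus m F → L (x j).rep = 0 := fun x hx => by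
    rw [← hL]
    rw [hup fun i => (x i).rep]
    exact hx
  obtain ⟨_, ⟨x, hx, rfl⟩, _, ⟨y, hy, rfl⟩, hxy⟩ := h.nontrivial
  have hi := (Projectivization.independent_iff.1
    ((Projectivization.independent_pair_iff_ne _ _).2 hxy))
  have hL0 : L = 0 := by
    refine (basisOfLinearIndependentOfCardEqFinrank hi (by simp [hm])).ext fun k => ?_
    rw [coe_basisOfLinearIndependentOfCardEqFinrank]
    fin_cases k
    · simpa using hz x hx
    · simpa using hz y hy
  refine hF0 (MvPolynomial.funext fun v => ?_)
  have := hL fun l => v ⟨j, l⟩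
  rw [hup fun i l => v ⟨i, l⟩, hL0] at this
  simpa using this

end MultiProj

/-- for an irreducible divisor `D` of multidegree `(1,...,1)` in `(ℙ¹)^n`
and a projection `π` to a factor with `dim π(D) > 0` (i.e. infinite image), every fiber of
`π` over `ℙ¹` meets `D` in a connected set, and `π |_D` is surjective with connected
fibers. -/
theorem fibers_connected_and_surjective
    (n : ℕ) (hn : 1 ≤ n)
    (F : MvPolynomial (MultiProj.Idx (fun _ : Fin n => 1)) ℂ)
    (hirr : Irreducible F)
    (hdeg : MultiProj.IsMultiHomog (fun _ : Fin n => 1) F (fun _ => 1))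
    (i₀ : Fin n)
    (himg : Set.Infinite
      ((fun x : MultiProj.Pt (fun _ : Fin n => 1) => x i₀) ''
        MultiProj.zeroLocus (fun _ : Fin n => 1) F)) :
    (∀ pt : ℙ ℂ (Fin 2 → ℂ),
      IsConnected (MultiProj.zeroLocus (fun _ : Fin n => 1) F ∩
        (fun x : MultiProj.Pt (fun _ : Fin n => 1) => x i₀) ⁻¹' {pt})) ∧
    (∀ pt : ℙ ℂ (Fin 2 → ℂ),
      ∃ x ∈ MultiProj.zeroLocus (fun _ : Fin n => 1) F, x i₀ = pt) := by
  obtain ⟨j, hj⟩ := hdeg.exists_ne_of_infinite hirr.ne_zero rfl rfl himg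
  have h := hdeg.isConnected_fiber hj rfl fun _ => le_rfl
  refine ⟨h, fun pt => ?_⟩
  obtain ⟨x, hx, hpt⟩ := (h pt).nonempty
  exact ⟨x, hx, hpt⟩
end
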